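/- arXiv:1306.1409 — 6 statements merged into one kernel-verified Lean document; each statement's English description precedes it below -/
import Mathlib

section
/- Let d ≥ 1 and 1 ≤ γ_1 ≤ ⋯ ≤ γ_{d-1} be fixed integers. Then ∫_0^∞ (e^{−t} − e^{−2dt}·I_0^Γ(2t,…,2t)) dt/t = log 4 + ∫_0^1 log(sin²(πw) + ∑_{i=1}^{d-1} sin²(πγ_i w)) dw. -/
open Real MeasureTheory Filter Finset

/-- The `d`-dimensional modified `I`-Bessel function of order zero with parameter
set `Γ = {1, γ_1, …, γ_{d-1}}`, evaluated at `(u, …, u)`. -/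
noncomputable def I0Gamma (d : ℕ) (γ : Fin (d - 1) → ℕ) (u : ℝ) : ℝ :=
  (1 / (2 * π)) * ∫ w in (-π)..π, Real.exp (u * (Real.cos w + ∑ i, Real.cos (γ i * w)))

lemma abs_exp_neg_sub_exp_neg_div_le {a t : ℝ} (ht : 0 < t) :
    |(exp (-t) - exp (-(a * t))) / t| ≤ |a - 1| * exp (-(min 1 a) * t) := by
  have key : ∀ x y : ℝ, x ≤ y → exp (-x) - exp (-y) ≤ (y - x) * exp (-x) := by
    intro x y _
    have h := add_one_le_exp (x - y)
    have h2 : exp (-y) = exp (x - y) * exp (-x) := by rw [← exp_add]; ring_nf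
    rw [h2]
    nlinarith [exp_pos (-x)]
  rw [abs_div, abs_of_pos ht, div_le_iff₀ ht]
  rcases le_total 1 a with h | h
  · have h1 : t ≤ a * t := by nlinarith
    rw [min_eq_left h, abs_of_nonneg (by linarith : 0 ≤ a - 1),
      abs_of_nonneg (sub_nonneg.2 (exp_le_exp.2 (neg_le_neg h1)))]
    refine (key _ _ h1).trans_eq ?_
    ring_nf
  · have h1 : a * t ≤ t := by nlinarith
    rw [min_eq_right h, abs_of_nonpos (by linarith : a - 1 ≤ 0), abs_sub_comm,
      abs_of_nonneg (sub_nonneg.2 (exp_le_exp.2 (neg_le_neg h1)))]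
    refine (key _ _ h1).trans_eq ?_
    ring_nf

lemma integrableOn_exp_neg_sub_exp_neg_div {a : ℝ} (ha : 0 < a) :
    IntegrableOn (fun t => (exp (-t) - exp (-(a * t))) / t) (Set.Ioi 0) := by
  have hm : 0 < min 1 a := lt_min one_pos ha
  refine Integrable.mono' ((exp_neg_integrableOn_Ioi 0 hm).const_mul |a - 1|)
    (Measurable.aestronglyMeasurable (by fun_prop)) ?_
  filter_upwards [ae_restrict_mem measurableSet_Ioi] with t ht
  exact abs_exp_neg_sub_exp_neg_div_le ht

lemma integral_exp_neg_sub_exp_neg_div {a : ℝ} (ha : 0 < a) :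
    ∫ t in Set.Ioi 0, (exp (-t) - exp (-(a * t))) / t = log a := by
  have hc : Continuous fun x : ℝ => exp (-x) := by fun_prop
  have h := Frullani.integral_Ioi_eq (f := fun x : ℝ => exp (-x)) (a := 1) (b := a)
    (L := 1) (R := 0) (hc.locallyIntegrable.locallyIntegrableOn _) one_pos ha
    ((hc.tendsto' 0 1 (by simp)).mono_left nhdsWithin_le_nhds)
    (by simpa using tendsto_exp_neg_atTop_nhds_zero)
    (by simpa [div_eq_inv_mul] using integrableOn_exp_neg_sub_exp_neg_div ha)
  simpa [div_eq_inv_mul] using h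

lemma integral_abs_exp_neg_sub_exp_neg_div {a : ℝ} (ha : 0 < a) :
    ∫ t in Set.Ioi 0, |(exp (-t) - exp (-(a * t))) / t| = |log a| := by
  rcases le_total 1 a with h | h
  · rw [abs_of_nonneg (log_nonneg h), ← integral_exp_neg_sub_exp_neg_div ha]
    refine setIntegral_congr_fun measurableSet_Ioi fun t (ht : 0 < t) => abs_of_nonneg ?_
    exact div_nonneg (sub_nonneg.2 (exp_le_exp.2 (by nlinarith))) ht.le
  · rw [abs_of_nonpos (log_nonpos ha.le h), ← integral_exp_neg_sub_exp_neg_div ha,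
      ← integral_neg]
    refine setIntegral_congr_fun measurableSet_Ioi fun t (ht : 0 < t) => abs_of_nonpos ?_
    exact div_nonpos_of_nonpos_of_nonneg (sub_nonpos.2 (exp_le_exp.2 (by nlinarith))) ht.le

/-- Frullani's integral for the Laplace transform of a positive function. -/
lemma integral_exp_neg_sub_integral_exp_neg_div {α : Type*} [MeasurableSpace α]
    {μ : Measure α} [IsProbabilityMeasure μ] {f : α → ℝ} (hf : Measurable f)
    (hpos : ∀ᵐ x ∂μ, 0 < f x) (hlog : Integrable (fun x => log (f x)) μ) :
    ∫ t in Set.Ioi (0 : ℝ), (exp (-t) - ∫ x, exp (-(f x * t)) ∂μ) / t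
      = ∫ x, log (f x) ∂μ := by
  have hint : Integrable (Function.uncurry fun (x : α) (t : ℝ) =>
      (exp (-t) - exp (-(f x * t))) / t) (μ.prod (volume.restrict (Set.Ioi 0))) := by
    refine (integrable_prod_iff (Measurable.aestronglyMeasurable (by fun_prop))).2 ⟨?_, ?_⟩
    · filter_upwards [hpos] with x hx
      exact integrableOn_exp_neg_sub_exp_neg_div hx
    · refine hlog.abs.congr ?_
      filter_upwards [hpos] with x hx
      exact (integral_abs_exp_neg_sub_exp_neg_div hx).symm
  calc _ = ∫ t in Set.Ioi (0 : ℝ), ∫ x, (exp (-t) - exp (-(f x * t))) / t ∂μ := by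
        refine setIntegral_congr_fun measurableSet_Ioi fun t (ht : 0 < t) => ?_
        have hexp : Integrable (fun x => exp (-(f x * t))) μ := by
          refine Integrable.of_bound (C := 1)
            (Measurable.aestronglyMeasurable (by fun_prop)) ?_
          filter_upwards [hpos] with x hx
          rw [norm_eq_abs, abs_exp]
          exact exp_le_one_iff.2 (by nlinarith)
        simp only [integral_div]
        rw [integral_sub (integrable_const _) hexp]
        simp
    _ = ∫ x, (∫ t in Set.Ioi (0 : ℝ), (exp (-t) - exp (-(f x * t))) / t) ∂μ :=
        (integral_integral_swap hint).symm
    _ = _ := by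
        refine integral_congr_ae ?_
        filter_upwards [hpos] with x hx
        exact integral_exp_neg_sub_exp_neg_div hx

lemma exp_mul_I0Gamma (d : ℕ) (hd : 1 ≤ d) (γ : Fin (d - 1) → ℕ) (t : ℝ) :
    exp (-(2 * d) * t) * I0Gamma d γ (2 * t)
      = ∫ w in (0 : ℝ)..1,
          exp (-(4 * (sin (π * w) ^ 2 + ∑ i, sin (π * (γ i) * w) ^ 2) * t)) := by
  set F : ℝ → ℝ := fun w => exp (2 * t * (cos w + ∑ i, cos (γ i * w))) with hF
  have hper : Function.Periodic F (2 * π) := by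
    intro w
    have h (i : Fin (d - 1)) : cos (γ i * (w + 2 * π)) = cos (γ i * w) := by
      rw [mul_add, cos_add_nat_mul_two_pi]
    simp only [hF, h, cos_add_two_pi]
  have h1 : ∫ w in (-π)..π, F w = ∫ w in (0 : ℝ)..(2 * π), F w := by
    have := hper.intervalIntegral_add_eq (-π) 0
    rwa [zero_add, show -π + 2 * π = π by ring] at this
  have h2 : (1 / (2 * π)) * ∫ w in (0 : ℝ)..(2 * π), F w
      = ∫ w in (0 : ℝ)..1, F (2 * π * w) := by
    rw [intervalIntegral.integral_comp_mul_left _ (by positivity : 2 * π ≠ 0)]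
    simp
  rw [I0Gamma, h1, h2, ← intervalIntegral.integral_const_mul]
  refine intervalIntegral.integral_congr fun w _ => ?_
  have hcos (x : ℝ) : cos (2 * x) = 1 - 2 * sin x ^ 2 := by
    rw [cos_two_mul, cos_sq']; ring
  have hsum : ∑ i, cos (γ i * (2 * π * w))
      = (d - 1 : ℝ) - 2 * ∑ i, sin (π * (γ i) * w) ^ 2 := by
    have h (i : Fin (d - 1)) :
        cos (γ i * (2 * π * w)) = 1 - 2 * sin (π * (γ i) * w) ^ 2 := by
      rw [← hcos]; ring_nf
    simp [h, Finset.sum_sub_distrib, Finset.mul_sum, Nat.cast_sub hd]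
  simp only [hF]
  rw [← exp_add, hsum, mul_assoc 2 π w, hcos]
  ring_nf

lemma integrableOn_log_sin_sq_add {g : ℝ → ℝ} (hg : Measurable g) (hg0 : ∀ w, 0 ≤ g w)
    {C : ℝ} (hgC : ∀ w, g w ≤ C) :
    IntegrableOn (fun w => log (sin (π * w) ^ 2 + g w)) (Set.Ioo 0 1) := by
  have hls : IntegrableOn (fun w => log (sin (π * w))) (Set.Ioo 0 1) := by
    have h := (intervalIntegrable_log_sin (a := 0) (b := π)).comp_mul_left (c := π)
    rw [zero_div, div_self pi_ne_zero, intervalIntegrable_iff_integrableOn_Ioo_of_le zero_le_one]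
      at h
    exact h
  refine Integrable.mono' ((hls.abs.const_mul 2).add (integrable_const |log (1 + C)|))
    (Measurable.aestronglyMeasurable (by fun_prop)) ?_
  filter_upwards [ae_restrict_mem measurableSet_Ioo] with w hw
  have hsin : 0 < sin (π * w) :=
    sin_pos_of_pos_of_lt_pi (by nlinarith [pi_pos, hw.1]) (by nlinarith [pi_pos, hw.2])
  have hs2 : 0 < sin (π * w) ^ 2 := by positivity
  have hlow : 2 * log (sin (π * w)) ≤ log (sin (π * w) ^ 2 + g w) := by
    have := log_le_log hs2 (le_add_of_nonneg_right (hg0 w))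
    simpa using this
  have hup : log (sin (π * w) ^ 2 + g w) ≤ log (1 + C) :=
    log_le_log (by linarith [hg0 w]) (add_le_add (sin_sq_le_one _) (hgC w))
  simp only [Pi.add_apply, norm_eq_abs]
  rw [abs_le]
  constructor
  · linarith [neg_abs_le (log (sin (π * w))), abs_nonneg (log (1 + C))]
  · linarith [le_abs_self (log (1 + C)), abs_nonneg (log (sin (π * w)))]

theorem lead_term_formula (d : ℕ) (hd : 1 ≤ d) (γ : Fin (d - 1) → ℕ)
    (hγ : ∀ i, 1 ≤ γ i) (hmono : Monotone γ) :
    ∫ t in Set.Ioi (0 : ℝ),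
        (Real.exp (-t) - Real.exp (-(2 * d) * t) * I0Gamma d γ (2 * t)) / t
      = Real.log 4 + ∫ w in (0 : ℝ)..1,
          Real.log (Real.sin (π * w) ^ 2 + ∑ i, Real.sin (π * (γ i) * w) ^ 2) := by
  set g : ℝ → ℝ := fun w => ∑ i, sin (π * (γ i) * w) ^ 2 with hg
  have hgm : Measurable g := by fun_prop
  have hg0 (w : ℝ) : 0 ≤ g w := Finset.sum_nonneg fun i _ => sq_nonneg _
  have hgC (w : ℝ) : g w ≤ (d - 1 : ℕ) := by
    calc g w ≤ ∑ _i : Fin (d - 1), (1 : ℝ) :=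
        Finset.sum_le_sum fun i _ => sin_sq_le_one _
      _ = (d - 1 : ℕ) := by simp
  have hprob : IsProbabilityMeasure (volume.restrict (Set.Ioo (0 : ℝ) 1)) := ⟨by simp⟩
  have hint := integrableOn_log_sin_sq_add hgm hg0 hgC
  have hpos : ∀ᵐ w ∂volume.restrict (Set.Ioo (0 : ℝ) 1), 0 < sin (π * w) ^ 2 + g w := by
    filter_upwards [ae_restrict_mem measurableSet_Ioo] with w hw
    have hsin : 0 < sin (π * w) :=
      sin_pos_of_pos_of_lt_pi (by nlinarith [pi_pos, hw.1]) (by nlinarith [pi_pos, hw.2])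
    exact add_pos_of_pos_of_nonneg (pow_pos hsin 2) (hg0 w)
  have hlog : (fun w => log (4 * (sin (π * w) ^ 2 + g w)))
      =ᵐ[volume.restrict (Set.Ioo (0 : ℝ) 1)] fun w => log 4 + log (sin (π * w) ^ 2 + g w) := by
    filter_upwards [hpos] with w hw
    exact log_mul (by norm_num) hw.ne'
  have key := integral_exp_neg_sub_integral_exp_neg_div
    (f := fun w => 4 * (sin (π * w) ^ 2 + g w)) (by fun_prop)
    (hpos.mono fun w hw => mul_pos four_pos hw) (((integrable_const _).add hint).congr hlog.symm)
  rw [integral_congr_ae hlog, integral_add (integrable_const _) hint] at key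
  simp only [exp_mul_I0Gamma d hd, intervalIntegral.integral_of_le zero_le_one,
    integral_Ioc_eq_integral_Ioo]
  simpa using key
end

section
/- Let (a_n) be a sequence of positive integers with a_n/n → 0 as n → ∞. Then for every t > 0, lim_{n→∞} a_n·e^{−2n²t}·∑_{k∈ℤ} I_{a_n k}(2n²t) = 1. -/
open Real MeasureTheory Filter Finset

/-- The modified `I`-Bessel function of integer order `m`. -/
noncomputable def besselI (m : ℤ) (t : ℝ) : ℝ :=
  (1 / (2 * π)) * ∫ θ in (-π)..π, Real.exp (t * Real.cos θ) * Real.cos (m * θ)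

theorem sq_mul_integral_exp_cos_mul_cos (x : ℝ) (m : ℤ) :
    (m : ℝ) ^ 2 * ∫ θ in (-π)..π, Real.exp (x * Real.cos θ) * Real.cos (m * θ) =
      ∫ θ in (-π)..π, Real.exp (x * Real.cos θ) *
        (x * Real.cos θ - (x * Real.sin θ) ^ 2) * Real.cos (m * θ) := by
  have hf : ∀ θ : ℝ, HasDerivAt (fun θ => Real.exp (x * Real.cos θ))
      (-(Real.exp (x * Real.cos θ) * (x * Real.sin θ))) θ := fun θ => by
    convert! ((Real.hasDerivAt_cos θ).const_mul x).exp using 1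
    ring
  have hf' : ∀ θ : ℝ, HasDerivAt (fun θ => Real.exp (x * Real.cos θ) * (x * Real.sin θ))
      (Real.exp (x * Real.cos θ) * (x * Real.cos θ - (x * Real.sin θ) ^ 2)) θ := fun θ => by
    convert! (hf θ).mul ((Real.hasDerivAt_sin θ).const_mul x) using 1
    ring
  have hs : ∀ θ : ℝ, HasDerivAt (fun θ => Real.sin (m * θ)) (m * Real.cos (m * θ)) θ := fun θ => by
    convert! ((hasDerivAt_id θ).const_mul (m : ℝ)).sin using 1
    simp [mul_comm]
  have hc : ∀ θ : ℝ, HasDerivAt (fun θ => -Real.cos (m * θ)) (m * Real.sin (m * θ)) θ := fun θ => by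
    convert! ((hasDerivAt_id θ).const_mul (m : ℝ)).cos.neg using 1
    simp [mul_comm]
  have first := intervalIntegral.integral_mul_deriv_eq_deriv_mul (a := -π) (b := π)
    (fun θ _ => hf θ) (fun θ _ => hs θ)
    (Continuous.intervalIntegrable (by fun_prop) _ _)
    (Continuous.intervalIntegrable (by fun_prop) _ _)
  have second := intervalIntegral.integral_mul_deriv_eq_deriv_mul (a := -π) (b := π)
    (fun θ _ => hf' θ) (fun θ _ => hc θ)
    (Continuous.intervalIntegrable (by fun_prop) _ _)
    (Continuous.intervalIntegrable (by fun_prop) _ _)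
  simp only [mul_neg, Real.sin_neg, Real.sin_int_mul_pi, Real.sin_pi, neg_zero, mul_zero, zero_mul,
    zero_sub, neg_mul, intervalIntegral.integral_neg, neg_neg, sub_self] at first second
  rw [pow_two, mul_assoc, ← second, ← intervalIntegral.integral_const_mul]
  have h1 : ∀ θ : ℝ, (m : ℝ) * (Real.exp (x * Real.cos θ) * Real.cos (m * θ)) =
      Real.exp (x * Real.cos θ) * (m * Real.cos (m * θ)) := fun θ => by ring
  have h2 : ∀ θ : ℝ, Real.exp (x * Real.cos θ) * (x * Real.sin θ) * (m * Real.sin (m * θ)) =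
      m * (Real.exp (x * Real.cos θ) * (x * Real.sin θ) * Real.sin (m * θ)) := fun θ => by ring
  simp_rw [h1, h2]
  rw [first, intervalIntegral.integral_const_mul]

theorem exists_sq_mul_abs_besselI_le (x : ℝ) :
    ∃ C : ℝ, ∀ m : ℤ, (m : ℝ) ^ 2 * |besselI m x| ≤ C := by
  set g : ℝ → ℝ := fun θ =>
    Real.exp (x * Real.cos θ) * (x * Real.cos θ - (x * Real.sin θ) ^ 2) with hg
  have hgc : Continuous g := by fun_prop
  refine ⟨1 / (2 * π) * ∫ θ in (-π)..π, |g θ|, fun m => ?_⟩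
  have hpi : (0 : ℝ) < 1 / (2 * π) := by positivity
  have hle : -π ≤ π := by linarith [Real.pi_pos]
  rw [besselI, abs_mul, abs_of_pos hpi, mul_left_comm, ← abs_of_nonneg (sq_nonneg (m : ℝ)),
    ← abs_mul, sq_mul_integral_exp_cos_mul_cos]
  gcongr
  refine (intervalIntegral.abs_integral_le_integral_abs hle).trans ?_
  refine intervalIntegral.integral_mono_on hle (Continuous.intervalIntegrable (by fun_prop) _ _)
    (Continuous.intervalIntegrable (by fun_prop) _ _) fun θ _ => ?_
  rw [abs_mul]
  exact mul_le_of_le_one_right (abs_nonneg _) (Real.abs_cos_le_one _)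

theorem summable_besselI (x : ℝ) : Summable fun m : ℤ => besselI m x := by
  obtain ⟨C, hC⟩ := exists_sq_mul_abs_besselI_le x
  refine Summable.of_norm_bounded_eventually
    ((Real.summable_one_div_int_pow.mpr one_lt_two).mul_left C) ?_
  filter_upwards [(Set.finite_singleton (0 : ℤ)).compl_mem_cofinite] with m hm
  have hm0 : (0 : ℝ) < (m : ℝ) ^ 2 := by
    have : (m : ℝ) ≠ 0 := by exact_mod_cast hm
    positivity
  rw [Real.norm_eq_abs, mul_one_div, le_div_iff₀ hm0, mul_comm]
  exact hC m

theorem integral_exp_cos_mul_sin (x : ℝ) (m : ℤ) :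
    ∫ θ in (-π)..π, Real.exp (x * Real.cos θ) * Real.sin (m * θ) = 0 := by
  have h := intervalIntegral.integral_comp_neg (a := -π) (b := π)
    (fun θ : ℝ => Real.exp (x * Real.cos θ) * Real.sin (m * θ))
  simp only [Real.cos_neg, mul_neg, Real.sin_neg, intervalIntegral.integral_neg, neg_neg] at h
  linarith

theorem hasSum_besselI_mul_exp (x θ : ℝ) :
    HasSum (fun m : ℤ => (besselI m x : ℂ) * Complex.exp (m * θ * Complex.I))
      (Real.exp (x * Real.cos θ) : ℂ) := by
  have : Fact (0 < 2 * π) := ⟨Real.two_pi_pos⟩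
  let F : C(AddCircle (2 * π), ℂ) :=
    ⟨fun φ => ((Real.exp (x * (fourier 1 φ : ℂ).re) : ℝ) : ℂ), by fun_prop⟩
  have hfourier : ∀ (m : ℤ) (φ : ℝ), (fourier m (φ : AddCircle (2 * π)) : ℂ) =
      Complex.exp (m * φ * Complex.I) := fun m φ => by
    rw [fourier_coe_apply]
    congr 1
    have : (π : ℂ) ≠ 0 := by exact_mod_cast Real.pi_ne_zero
    push_cast
    field_simp
  have hF : ∀ φ : ℝ, F (φ : AddCircle (2 * π)) = (Real.exp (x * Real.cos φ) : ℂ) := fun φ => by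
    simp only [F, ContinuousMap.coe_mk, hfourier, Int.cast_one, one_mul,
      Complex.exp_ofReal_mul_I_re]
  have hcoeff : ∀ m : ℤ, fourierCoeff F m = (besselI m x : ℂ) := fun m => by
    rw [fourierCoeff_eq_intervalIntegral F m (-π), show -π + 2 * π = π by ring, besselI]
    have hint : ∀ φ : ℝ, (fourier (-m) (φ : AddCircle (2 * π)) : ℂ) • F φ =
        ((Real.exp (x * Real.cos φ) * Real.cos (m * φ) : ℝ) : ℂ) -
          ((Real.exp (x * Real.cos φ) * Real.sin (m * φ) : ℝ) : ℂ) * Complex.I := fun φ => by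
      rw [hF, hfourier, smul_eq_mul, Complex.exp_mul_I]
      push_cast
      rw [neg_mul, Complex.cos_neg, Complex.sin_neg]
      ring
    simp_rw [hint]
    rw [intervalIntegral.integral_sub (Continuous.intervalIntegrable (by fun_prop) _ _)
      (Continuous.intervalIntegrable (by fun_prop) _ _), intervalIntegral.integral_mul_const,
      intervalIntegral.integral_ofReal, intervalIntegral.integral_ofReal,
      integral_exp_cos_mul_sin]
    simp
  have hsum : Summable (fourierCoeff F) := by
    rw [show fourierCoeff F = fun m : ℤ => (besselI m x : ℂ) from funext hcoeff]
    exact_mod_cast summable_besselI x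
  have h := has_pointwise_sum_fourier_series_of_summable hsum (θ : AddCircle (2 * π))
  simpa only [hF, hcoeff, hfourier, smul_eq_mul] using h

theorem sum_range_exp_two_pi_mul_div (a : ℕ) (ha : 0 < a) (m : ℤ) :
    ∑ j ∈ range a, Complex.exp (m * ((2 * π * j / a : ℝ) : ℂ) * Complex.I) =
      if (a : ℤ) ∣ m then (a : ℂ) else 0 := by
  have hprim := Complex.isPrimitiveRoot_exp a ha.ne'
  set ζ := Complex.exp (2 * π * Complex.I / a) with hζ
  have hterm : ∀ j : ℕ, Complex.exp (m * ((2 * π * j / a : ℝ) : ℂ) * Complex.I) = (ζ ^ m) ^ j :=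
    fun j => by
      rw [hζ, ← Complex.exp_int_mul, ← Complex.exp_nat_mul]
      congr 1
      push_cast
      ring
  simp_rw [hterm]
  split_ifs with hdvd
  · simp [(hprim.zpow_eq_one_iff_dvd m).mpr hdvd]
  · have hne : ζ ^ m ≠ 1 := fun h => hdvd ((hprim.zpow_eq_one_iff_dvd m).mp h)
    rw [geom_sum_eq hne, ← zpow_natCast, ← zpow_mul, mul_comm, zpow_mul, zpow_natCast,
      hprim.pow_eq_one, one_zpow, sub_self, zero_div]

/-- The theta inversion formula on `ℤ / aℤ`. -/
theorem mul_tsum_besselI_eq_sum (a : ℕ) (ha : 0 < a) (x : ℝ) :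
    (a : ℝ) * ∑' k : ℤ, besselI (a * k) x =
      ∑ j ∈ range a, Real.exp (x * Real.cos (2 * π * j / a)) := by
  have hinj : Function.Injective fun k : ℤ => (a : ℤ) * k :=
    mul_right_injective₀ (by exact_mod_cast ha.ne')
  have h := hasSum_sum (s := range a) fun j _ => hasSum_besselI_mul_exp x (2 * π * j / a)
  simp_rw [← Finset.mul_sum, sum_range_exp_two_pi_mul_div a ha] at h
  rw [← hinj.hasSum_iff] at h
  · have h' : HasSum (fun k : ℤ => besselI (a * k) x * (a : ℝ))
        (∑ j ∈ range a, Real.exp (x * Real.cos (2 * π * j / a))) := by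
      rw [← Complex.hasSum_ofReal]
      simpa [Function.comp_def] using h
    rw [mul_comm, ← tsum_mul_right, h'.tsum_eq]
  · intro m hm
    rw [if_neg, mul_zero]
    rintro ⟨k, rfl⟩
    exact hm ⟨k, rfl⟩

theorem exp_neg_mul_sin_sq_le {a j : ℕ} (hj : 0 < j) (hja : 2 * j ≤ a) {y : ℝ} (hy : 0 ≤ y) :
    Real.exp (-(y * Real.sin (π * j / a) ^ 2)) ≤ Real.exp (-(4 * y / a ^ 2)) ^ j := by
  have ha : (0 : ℝ) < a := by exact_mod_cast (by omega : 0 < a)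
  have hja' : 2 * (j : ℝ) ≤ a := by exact_mod_cast hja
  have hj' : (1 : ℝ) ≤ j := by exact_mod_cast hj
  have hsin : 2 * j / a ≤ Real.sin (π * j / a) := by
    have h := Real.mul_le_sin (x := π * j / a) (by positivity) (by
      rw [div_le_div_iff₀ ha two_pos]
      nlinarith [Real.pi_pos])
    refine le_trans (le_of_eq ?_) h
    field_simp
  have hsq : (2 * j / a : ℝ) ^ 2 ≤ Real.sin (π * j / a) ^ 2 := by gcongr
  rw [← Real.exp_nat_mul, Real.exp_le_exp]
  have h1 : (j : ℝ) * (4 * y / a ^ 2) ≤ y * (2 * j / a) ^ 2 := by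
    rw [show y * (2 * j / a : ℝ) ^ 2 = (j * (4 * y / a ^ 2)) * j by ring]
    exact le_mul_of_one_le_right (by positivity) hj'
  nlinarith [mul_le_mul_of_nonneg_left hsq hy]

theorem exp_neg_mul_sin_sq_le_add {a j : ℕ} (hj : 0 < j) (hja : j < a) {y : ℝ} (hy : 0 ≤ y) :
    Real.exp (-(y * Real.sin (π * j / a) ^ 2)) ≤
      Real.exp (-(4 * y / a ^ 2)) ^ j + Real.exp (-(4 * y / a ^ 2)) ^ (a - j) := by
  rcases le_total (2 * j) a with h | h
  · exact (exp_neg_mul_sin_sq_le hj h hy).trans (le_add_of_nonneg_right (by positivity))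
  · refine le_trans (le_of_eq ?_) ((exp_neg_mul_sin_sq_le (a := a) (j := a - j) (by omega)
      (by omega) hy).trans (le_add_of_nonneg_left (by positivity)))
    have ha : (a : ℝ) ≠ 0 := by exact_mod_cast (by omega : a ≠ 0)
    rw [Nat.cast_sub hja.le, show π * ((a : ℝ) - j) / a = π - π * j / a by field_simp,
      Real.sin_pi_sub]

theorem sum_range_exp_neg_mul_sin_sq_le {a : ℕ} (ha : 0 < a) {y : ℝ} (hy : 0 < y) :
    ∑ j ∈ range a, Real.exp (-(y * Real.sin (π * j / a) ^ 2)) ≤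
      1 + 2 * (Real.exp (-(4 * y / a ^ 2)) / (1 - Real.exp (-(4 * y / a ^ 2)))) := by
  set q := Real.exp (-(4 * y / a ^ 2)) with hq
  have ha' : (0 : ℝ) < a := by exact_mod_cast ha
  have hq0 : 0 < q := Real.exp_pos _
  have hq1 : q < 1 := Real.exp_lt_one_iff.mpr (by rw [neg_lt_zero]; positivity)
  obtain ⟨b, rfl⟩ : ∃ b, a = b + 1 := ⟨a - 1, by omega⟩
  have hgeom : ∑ j ∈ range b, q ^ (j + 1) ≤ q / (1 - q) := by
    simp_rw [pow_succ']
    rw [← Finset.mul_sum, div_eq_mul_inv, ← tsum_geometric_of_lt_one hq0.le hq1]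
    gcongr
    exact (summable_geometric_of_lt_one hq0.le hq1).sum_le_tsum _ fun _ _ => by positivity
  have hreflect : ∑ j ∈ range b, q ^ (b + 1 - (j + 1)) = ∑ j ∈ range b, q ^ (j + 1) := by
    rw [← Finset.sum_range_reflect]
    refine Finset.sum_congr rfl fun j hj => ?_
    have := Finset.mem_range.mp hj
    congr 1
    omega
  have hbound : ∑ j ∈ range b,
      Real.exp (-(y * Real.sin (π * (j + 1 : ℕ) / (b + 1 : ℕ)) ^ 2)) ≤
        ∑ j ∈ range b, (q ^ (j + 1) + q ^ (b + 1 - (j + 1))) :=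
    Finset.sum_le_sum fun j hj => exp_neg_mul_sin_sq_le_add j.succ_pos
      (by have := Finset.mem_range.mp hj; omega) hy.le
  rw [Finset.sum_add_distrib, hreflect] at hbound
  rw [Finset.sum_range_succ']
  simp only [Nat.cast_zero, mul_zero, zero_div, Real.sin_zero, ne_eq, OfNat.ofNat_ne_zero,
    not_false_eq_true, zero_pow, neg_zero, Real.exp_zero]
  linarith

theorem one_le_sum_range_exp_neg_mul_sin_sq {a : ℕ} (ha : 0 < a) (y : ℝ) :
    1 ≤ ∑ j ∈ range a, Real.exp (-(y * Real.sin (π * j / a) ^ 2)) := by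
  refine le_trans (le_of_eq ?_) (Finset.single_le_sum
    (f := fun j : ℕ => Real.exp (-(y * Real.sin (π * j / a) ^ 2)))
    (fun j _ => (Real.exp_pos _).le) (Finset.mem_range.mpr ha))
  norm_num

theorem mul_exp_mul_tsum_besselI (a : ℕ) (ha : 0 < a) (s : ℝ) :
    (a : ℝ) * Real.exp (-s) * ∑' k : ℤ, besselI (a * k) s =
      ∑ j ∈ range a, Real.exp (-(2 * s * Real.sin (π * j / a) ^ 2)) := by
  rw [mul_right_comm, mul_tsum_besselI_eq_sum a ha, Finset.sum_mul]
  refine Finset.sum_congr rfl fun j _ => ?_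
  rw [← Real.exp_add, show 2 * π * j / a = 2 * (π * j / a) by ring, Real.cos_two_mul,
    Real.cos_sq']
  congr 1
  ring

theorem bessel_sum_limit (a : ℕ → ℕ) (ha : ∀ n, 0 < a n)
    (hsub : Tendsto (fun n : ℕ => (a n : ℝ) / n) atTop (nhds 0))
    (t : ℝ) (ht : 0 < t) :
    Tendsto (fun n : ℕ =>
        (a n : ℝ) * Real.exp (-2 * n ^ 2 * t) *
          ∑' k : ℤ, besselI (a n * k) (2 * n ^ 2 * t))
      atTop (nhds 1) := by
  have hrw : ∀ n : ℕ, (a n : ℝ) * Real.exp (-2 * n ^ 2 * t) *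
      ∑' k : ℤ, besselI (a n * k) (2 * n ^ 2 * t) =
        ∑ j ∈ range (a n), Real.exp (-(2 * (2 * n ^ 2 * t) * Real.sin (π * j / a n) ^ 2)) :=
    fun n => by
      rw [← mul_exp_mul_tsum_besselI (a n) (ha n)]
      congr 3
      ring
  simp_rw [hrw]
  have hratio : Tendsto (fun n : ℕ => (n : ℝ) / a n) atTop atTop := by
    have h : Tendsto (fun n : ℕ => (a n : ℝ) / n) atTop (nhdsWithin 0 (Set.Ioi 0)) := by
      refine tendsto_nhdsWithin_iff.mpr ⟨hsub, ?_⟩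
      filter_upwards [eventually_gt_atTop 0] with n hn
      have := ha n
      exact Set.mem_Ioi.mpr (by positivity)
    exact h.inv_tendsto_nhdsGT_zero.congr fun n => inv_div _ _
  have hq : Tendsto (fun n : ℕ => Real.exp (-(4 * (2 * (2 * n ^ 2 * t)) / a n ^ 2))) atTop
      (nhds 0) := by
    refine Real.tendsto_exp_neg_atTop_nhds_zero.comp ?_
    refine (((tendsto_pow_atTop two_ne_zero).comp hratio).const_mul_atTop
      (by positivity : 0 < 16 * t)).congr fun n => ?_
    simp only [Function.comp_apply]
    ring
  have hupper : Tendsto (fun n : ℕ => 1 + 2 * (Real.exp (-(4 * (2 * (2 * n ^ 2 * t)) / a n ^ 2)) /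
      (1 - Real.exp (-(4 * (2 * (2 * n ^ 2 * t)) / a n ^ 2))))) atTop (nhds 1) := by
    simpa using ((hq.div (hq.const_sub 1) (by norm_num)).const_mul 2).const_add 1
  refine tendsto_of_tendsto_of_tendsto_of_le_of_le' tendsto_const_nhds hupper
    (Eventually.of_forall fun n => one_le_sum_range_exp_neg_mul_sin_sq (ha n) _) ?_
  filter_upwards [eventually_gt_atTop 0] with n hn
  exact sum_range_exp_neg_mul_sin_sq_le (ha n) (by positivity)
end

section
/- Let d ≥ 1 and 1 ≤ γ_1 ≤ ⋯ ≤ γ_{d-1} be fixed integers and c_Γ = 1 + ∑_{i=1}^{d-1} γ_i². Then for every t > 0 and every integer k ≥ 1, lim_{n→∞} n·e^{−2dn²t}·I_{nk}^Γ(2n²t, …, 2n²t) = (4π c_Γ t)^{−1/2}·e^{−k²/(4 c_Γ t)}, and lim_{n→∞} n·e^{−2dn²t}·I_0^Γ(2n²t, …, 2n²t) = (4π c_Γ t)^{−1/2}. -/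
open Real MeasureTheory Filter Finset

/-- The `d`-dimensional modified `I`-Bessel function of integer order `m` with
parameter set `Γ = {1, γ_1, …, γ_{d-1}}`, evaluated at `(u, …, u)`. -/
noncomputable def IGamma (d : ℕ) (γ : Fin (d - 1) → ℕ) (m : ℤ) (u : ℝ) : ℝ :=
  (1 / (2 * π)) * ∫ w in (-π)..π,
    Real.exp (u * (Real.cos w + ∑ i, Real.cos (γ i * w))) * Real.cos (m * w)

theorem tendsto_sq_mul_one_sub_cos_div (a : ℝ) :
    Tendsto (fun n : ℕ => (n : ℝ) ^ 2 * (1 - Real.cos (a / n))) atTop (nhds (a ^ 2 / 2)) := by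
  have hsinc : Tendsto (fun n : ℕ => Real.sinc (a / 2 / n)) atTop (nhds 1) := by
    have h := (Real.continuous_sinc.tendsto 0).comp
      (tendsto_const_div_atTop_nhds_zero_nat (a / 2))
    rwa [Real.sinc_zero] at h
  have hlim := (hsinc.pow 2).const_mul (a ^ 2 / 2)
  rw [one_pow, mul_one] at hlim
  refine hlim.congr' ?_
  filter_upwards [eventually_gt_atTop 0] with n hn
  have hn' : (n : ℝ) ≠ 0 := by positivity
  rcases eq_or_ne a 0 with rfl | ha
  · simp
  have hcos : Real.cos (a / n) = 1 - 2 * Real.sin (a / 2 / n) ^ 2 := by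
    rw [← Real.cos_two_mul_eq_one_sub]
    congr 1
    ring
  rw [hcos, Real.sinc_of_ne_zero (by positivity)]
  field_simp
  ring

theorem integral_exp_neg_mul_sq_mul_cos {b : ℝ} (hb : 0 < b) (k : ℝ) :
    ∫ x : ℝ, Real.exp (-b * x ^ 2) * Real.cos (k * x) =
      √(π / b) * Real.exp (-k ^ 2 / (4 * b)) := by
  have h := fourierIntegral_gaussian (b := (b : ℂ)) (by simpa using hb) (k : ℂ)
  have hint : Integrable fun x : ℝ =>
      Complex.exp (Complex.I * k * x) * Complex.exp (-b * x ^ 2) := by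
    have h0 : Integrable fun x : ℝ => Complex.exp (-b * x ^ 2 + Complex.I * k * x + 0) :=
      integrable_cexp_quadratic (by simpa using hb) _ _
    refine h0.congr (ae_of_all _ fun x => ?_)
    simp only [← Complex.exp_add]
    ring_nf
  have hre := congrArg Complex.re h
  rw [← RCLike.re_eq_complex_re, ← integral_re hint] at hre
  have hright : ((π : ℂ) / b) ^ (1 / 2 : ℂ) * Complex.exp (-(k : ℂ) ^ 2 / (4 * b)) =
      ((√(π / b) * Real.exp (-k ^ 2 / (4 * b)) : ℝ) : ℂ) := by
    rw [Real.sqrt_eq_rpow]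
    push_cast [Complex.ofReal_cpow (show 0 ≤ π / b by positivity)]
    rfl
  rw [hright] at hre
  simp only [RCLike.re_eq_complex_re, Complex.ofReal_re] at hre
  rw [← hre]
  congr 1 with x
  have h1 : Complex.exp (-b * x ^ 2) = (Real.exp (-b * x ^ 2) : ℂ) := by push_cast; rfl
  rw [h1, Complex.re_mul_ofReal, Complex.exp_re]
  simp [mul_comm]

/-- The rescaled exponential factor of the integrand. -/
noncomputable def heatWeight {ι : Type*} [Fintype ι] (γ : ι → ℕ) (t : ℝ) (n : ℕ) (x : ℝ) : ℝ :=
  Real.exp (-(2 * t) * ((n : ℝ) ^ 2 * (1 - Real.cos (x / n)) +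
    ∑ i, (n : ℝ) ^ 2 * (1 - Real.cos (γ i * x / n))))

section heatWeight

variable {ι : Type*} [Fintype ι] (γ : ι → ℕ)

theorem continuous_heatWeight (t : ℝ) (n : ℕ) : Continuous (heatWeight γ t n) := by
  unfold heatWeight
  fun_prop

theorem tendsto_heatWeight (t x : ℝ) :
    Tendsto (fun n => heatWeight γ t n x) atTop
      (nhds (Real.exp (-((1 + ∑ i, (γ i : ℝ) ^ 2) * t) * x ^ 2))) := by
  have h := ((tendsto_sq_mul_one_sub_cos_div x).add (tendsto_finsetSum univ fun i _ =>
    tendsto_sq_mul_one_sub_cos_div (γ i * x))).const_mul (-(2 * t))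
  have hval : -((1 + ∑ i, (γ i : ℝ) ^ 2) * t) * x ^ 2 =
      -(2 * t) * (x ^ 2 / 2 + ∑ i, (γ i * x) ^ 2 / 2) := by
    simp only [mul_pow, ← Finset.sum_div, ← Finset.sum_mul]
    ring
  rw [hval]
  exact (Real.continuous_exp.tendsto _).comp h

theorem heatWeight_le {t : ℝ} (ht : 0 < t) {n : ℕ} (hn : 0 < n) {x : ℝ} (hx : |x| ≤ π * n) :
    heatWeight γ t n x ≤ Real.exp (-(4 * t / π ^ 2) * x ^ 2) := by
  have hn' : (0 : ℝ) < n := by exact_mod_cast hn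
  have hcos := Real.cos_le_one_sub_mul_cos_sq (x := x / n)
    (by rwa [abs_div, abs_of_pos hn', div_le_iff₀ hn'])
  have hsum : 0 ≤ ∑ i, (n : ℝ) ^ 2 * (1 - Real.cos (γ i * x / n)) :=
    Finset.sum_nonneg fun i _ => mul_nonneg (by positivity)
      (by linarith [Real.cos_le_one (γ i * x / n)])
  have hmain : 2 / π ^ 2 * x ^ 2 ≤ (n : ℝ) ^ 2 * (1 - Real.cos (x / n)) := by
    calc 2 / π ^ 2 * x ^ 2 = (n : ℝ) ^ 2 * (2 / π ^ 2 * (x / n) ^ 2) := by field_simp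
      _ ≤ _ := by gcongr; linarith
  refine Real.exp_le_exp.2 ?_
  calc _ ≤ -(2 * t) * (2 / π ^ 2 * x ^ 2) :=
        mul_le_mul_of_nonpos_left (by linarith) (by linarith)
    _ = _ := by ring

theorem tendsto_integral_heatWeight_mul_cos {t : ℝ} (ht : 0 < t) (k : ℝ) :
    Tendsto (fun n : ℕ => ∫ x in (-π * n)..(π * n), heatWeight γ t n x * Real.cos (k * x))
      atTop (nhds (∫ x : ℝ,
        Real.exp (-((1 + ∑ i, (γ i : ℝ) ^ 2) * t) * x ^ 2) * Real.cos (k * x))) := by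
  have hset : ∀ n : ℕ, (∫ x in (-π * n)..(π * n), heatWeight γ t n x * Real.cos (k * x)) =
      ∫ x, (Set.Ioc (-π * n) (π * n)).indicator
        (fun x => heatWeight γ t n x * Real.cos (k * x)) x := fun n => by
    rw [integral_indicator measurableSet_Ioc, intervalIntegral.integral_of_le]
    nlinarith [Real.pi_pos, n.cast_nonneg (α := ℝ)]
  simp_rw [hset]
  refine tendsto_integral_filter_of_dominated_convergence
    (fun x => Real.exp (-(4 * t / π ^ 2) * x ^ 2)) ?_ ?_
    (integrable_exp_neg_mul_sq (by positivity)) ?_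
  · refine Eventually.of_forall fun n => ?_
    have hcont : Continuous fun x => heatWeight γ t n x * Real.cos (k * x) :=
      (continuous_heatWeight γ t n).mul (by fun_prop)
    exact hcont.aestronglyMeasurable.indicator measurableSet_Ioc
  · filter_upwards [eventually_gt_atTop 0] with n hn
    refine ae_of_all _ fun x => ?_
    by_cases hx : x ∈ Set.Ioc (-π * n) (π * n)
    · rw [Set.indicator_of_mem hx, norm_mul, Real.norm_eq_abs, Real.norm_eq_abs,
        abs_of_pos (show 0 < heatWeight γ t n x from Real.exp_pos _)]
      calc _ ≤ heatWeight γ t n x * 1 :=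
            mul_le_mul_of_nonneg_left (Real.abs_cos_le_one _) (Real.exp_pos _).le
        _ ≤ _ := by
            rw [mul_one]
            exact heatWeight_le γ ht hn (abs_le.2 ⟨by linarith [hx.1], hx.2⟩)
    · rw [Set.indicator_of_notMem hx, norm_zero]
      positivity
  · refine ae_of_all _ fun x => ?_
    refine ((tendsto_heatWeight γ t x).mul_const _).congr' ?_
    have hlarge : ∀ᶠ n : ℕ in atTop, |x| / π < n :=
      tendsto_natCast_atTop_atTop.eventually_gt_atTop _
    filter_upwards [hlarge] with n hn
    rw [div_lt_iff₀ Real.pi_pos, abs_lt] at hn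
    have hx : x ∈ Set.Ioc (-π * n) (π * n) := ⟨by linarith, by linarith⟩
    simp only [Set.indicator_of_mem hx]

end heatWeight

theorem mul_exp_mul_IGamma_eq {d : ℕ} (hd : 1 ≤ d) (γ : Fin (d - 1) → ℕ) (t : ℝ) {n : ℕ}
    (hn : 0 < n) (k : ℕ) :
    (n : ℝ) * Real.exp (-(2 * d) * n ^ 2 * t) * IGamma d γ (n * k) (2 * n ^ 2 * t) =
      (1 / (2 * π)) * ∫ x in (-π * n)..(π * n), heatWeight γ t n x * Real.cos (k * x) := by
  have hn' : (n : ℝ) ≠ 0 := by positivity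
  have hsub := intervalIntegral.integral_comp_div (a := -π * n) (b := π * n) (c := n)
    (fun w => Real.exp (-(2 * d) * n ^ 2 * t) *
      (Real.exp (2 * n ^ 2 * t * (Real.cos w + ∑ i, Real.cos (γ i * w))) *
        Real.cos (((n * k : ℤ) : ℝ) * w))) hn'
  rw [mul_div_cancel_right₀ _ hn', mul_div_cancel_right₀ _ hn', smul_eq_mul,
    intervalIntegral.integral_const_mul] at hsub
  have hcongr : ∀ x : ℝ, heatWeight γ t n x * Real.cos (k * x) =
      Real.exp (-(2 * d) * n ^ 2 * t) *
      (Real.exp (2 * n ^ 2 * t * (Real.cos (x / n) + ∑ i, Real.cos (γ i * (x / n)))) *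
        Real.cos (((n * k : ℤ) : ℝ) * (x / n))) := fun x => by
    rw [← mul_assoc, ← Real.exp_add, heatWeight]
    congr 2
    · simp only [← Finset.mul_sum, Finset.sum_sub_distrib, Finset.sum_const, Finset.card_univ,
        Fintype.card_fin, nsmul_eq_mul, mul_div_assoc]
      push_cast [hd]
      ring
    · push_cast
      field_simp
  simp_rw [hcongr]
  rw [intervalIntegral.integral_const_mul, hsub, intervalIntegral.integral_const_mul, IGamma]
  ring

theorem tendsto_mul_exp_mul_IGamma {d : ℕ} (hd : 1 ≤ d) (γ : Fin (d - 1) → ℕ) {t : ℝ}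
    (ht : 0 < t) (k : ℕ) :
    Tendsto (fun n : ℕ =>
        (n : ℝ) * Real.exp (-(2 * d) * n ^ 2 * t) * IGamma d γ (n * k) (2 * n ^ 2 * t))
      atTop
      (nhds ((Real.sqrt (4 * π * (1 + ∑ i, (γ i : ℝ) ^ 2) * t))⁻¹ *
        Real.exp (-(k : ℝ) ^ 2 / (4 * (1 + ∑ i, (γ i : ℝ) ^ 2) * t)))) := by
  have h := (tendsto_integral_heatWeight_mul_cos γ ht k).const_mul (1 / (2 * π))
  set c : ℝ := 1 + ∑ i, (γ i : ℝ) ^ 2 with hc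
  have hc0 : 0 < c := by positivity
  rw [integral_exp_neg_mul_sq_mul_cos (by positivity)] at h
  have hsqrt : 1 / (2 * π) * √(π / (c * t)) = (√(4 * π * c * t))⁻¹ := by
    rw [← Real.sqrt_inv, ← Real.sqrt_sq (show 0 ≤ 1 / (2 * π) by positivity),
      ← Real.sqrt_mul (by positivity)]
    congr 1
    field_simp
    norm_num
  rw [← mul_assoc, hsqrt, ← mul_assoc] at h
  refine h.congr' ?_
  filter_upwards [eventually_gt_atTop 0] with n hn
  exact (mul_exp_mul_IGamma_eq hd γ t hn k).symm

theorem bessel_gamma_limits (d : ℕ) (hd : 1 ≤ d) (γ : Fin (d - 1) → ℕ)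
    (hγ : ∀ i, 1 ≤ γ i) (hmono : Monotone γ) :
    (∀ t : ℝ, 0 < t → ∀ k : ℕ, 1 ≤ k →
      Tendsto (fun n : ℕ =>
          (n : ℝ) * Real.exp (-(2 * d) * n ^ 2 * t) * IGamma d γ (n * k) (2 * n ^ 2 * t))
        atTop
        (nhds ((Real.sqrt (4 * π * (1 + ∑ i, (γ i : ℝ) ^ 2) * t))⁻¹ *
          Real.exp (-(k : ℝ) ^ 2 / (4 * (1 + ∑ i, (γ i : ℝ) ^ 2) * t))))) ∧
    (∀ t : ℝ, 0 < t →
      Tendsto (fun n : ℕ =>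
          (n : ℝ) * Real.exp (-(2 * d) * n ^ 2 * t) * IGamma d γ 0 (2 * n ^ 2 * t))
        atTop
        (nhds ((Real.sqrt (4 * π * (1 + ∑ i, (γ i : ℝ) ^ 2) * t))⁻¹))) := by
  refine ⟨fun t ht k _ => tendsto_mul_exp_mul_IGamma hd γ ht k, fun t ht => ?_⟩
  simpa using tendsto_mul_exp_mul_IGamma hd γ ht 0
end

section
/- Let d ≥ 1 and 1 ≤ γ_1 ≤ ⋯ ≤ γ_{d-1} be fixed integers and c_Γ = 1 + ∑_{i=1}^{d-1} γ_i². Then lim_{n→∞} ∫_1^∞ n·e^{−2dn²t}·I_0^Γ(2n²t, …, 2n²t) dt/t = 1/√(π c_Γ). -/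
open Real MeasureTheory Filter Finset

/-- `(1 - cos w) + ∑ i, (1 - cos (γ i * w))`, the gap between the maximal value `d` of the phase
of the Bessel integral and its value at `w`. -/
noncomputable def cosDefect {ι : Type*} [Fintype ι] (γ : ι → ℕ) (w : ℝ) : ℝ :=
  (1 - Real.cos w) + ∑ i, (1 - Real.cos (γ i * w))

/-- `x * exp (-2 d x²) * I₀(2 x²)`, the Bessel function rescaled so that it has a finite positive
limit at infinity. -/
noncomputable def scaledBessel (d : ℕ) (γ : Fin (d - 1) → ℕ) (x : ℝ) : ℝ :=
  x * (Real.exp (-(2 * d) * x ^ 2) * I0Gamma d γ (2 * x ^ 2))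

lemma continuous_cosDefect {ι : Type*} [Fintype ι] (γ : ι → ℕ) : Continuous (cosDefect γ) := by
  unfold cosDefect
  fun_prop

lemma le_cosDefect {ι : Type*} [Fintype ι] (γ : ι → ℕ) {w : ℝ} (hw : |w| ≤ π) :
    2 / π ^ 2 * w ^ 2 ≤ cosDefect γ w := by
  have h1 := Real.cos_le_one_sub_mul_cos_sq hw
  have h2 : 0 ≤ ∑ i, (1 - Real.cos (γ i * w)) :=
    Finset.sum_nonneg fun i _ => sub_nonneg.2 (Real.cos_le_one _)
  unfold cosDefect
  linarith

lemma tendsto_mul_sin_div_atTop (b : ℝ) :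
    Tendsto (fun x : ℝ => x * Real.sin (b / x)) atTop (nhds b) := by
  have h0 : Tendsto (fun x : ℝ => b / x) atTop (nhds 0) := tendsto_id.const_div_atTop b
  have h1 : Tendsto (fun x : ℝ => b * Real.sinc (b / x)) atTop (nhds b) := by
    simpa using ((Real.continuous_sinc.tendsto 0).comp h0).const_mul b
  refine h1.congr' ?_
  filter_upwards [eventually_gt_atTop 0] with x hx
  rcases eq_or_ne b 0 with rfl | hb
  · simp
  · rw [Real.sinc_of_ne_zero (div_ne_zero hb hx.ne')]
    field_simp

lemma tendsto_sq_mul_one_sub_cos_atTop (a v : ℝ) :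
    Tendsto (fun x : ℝ => 2 * x ^ 2 * (1 - Real.cos (a * (v / x)))) atTop
      (nhds (a ^ 2 * v ^ 2)) := by
  have h := (((tendsto_mul_sin_div_atTop (a * v / 2)).const_mul 2).pow 2)
  have e : (2 * (a * v / 2)) ^ 2 = a ^ 2 * v ^ 2 := by ring
  rw [e] at h
  refine h.congr fun x => ?_
  have h1 := Real.cos_sq' (a * v / 2 / x)
  have h2 := Real.cos_two_mul (a * v / 2 / x)
  rw [show 2 * (a * v / 2 / x) = a * (v / x) by ring] at h2
  rw [h2, h1]
  ring

lemma tendsto_sq_mul_cosDefect_atTop {ι : Type*} [Fintype ι] (γ : ι → ℕ) (v : ℝ) :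
    Tendsto (fun x : ℝ => 2 * x ^ 2 * cosDefect γ (v / x)) atTop
      (nhds ((1 + ∑ i, (γ i : ℝ) ^ 2) * v ^ 2)) := by
  have h := (tendsto_sq_mul_one_sub_cos_atTop 1 v).add
    (tendsto_finsetSum Finset.univ fun i _ => tendsto_sq_mul_one_sub_cos_atTop (γ i : ℝ) v)
  have e : (1 : ℝ) ^ 2 * v ^ 2 + ∑ i, (γ i : ℝ) ^ 2 * v ^ 2
      = (1 + ∑ i, (γ i : ℝ) ^ 2) * v ^ 2 := by
    rw [add_mul, Finset.sum_mul, one_pow]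
  rw [e] at h
  refine h.congr fun x => ?_
  rw [cosDefect, mul_add, Finset.mul_sum, one_mul]

lemma continuous_I0Gamma (d : ℕ) (γ : Fin (d - 1) → ℕ) : Continuous (I0Gamma d γ) := by
  unfold I0Gamma
  refine continuous_const.mul ?_
  apply intervalIntegral.continuous_parametric_intervalIntegral_of_continuous'
  fun_prop

lemma continuous_scaledBessel (d : ℕ) (γ : Fin (d - 1) → ℕ) :
    Continuous (scaledBessel d γ) := by
  have := continuous_I0Gamma d γ
  unfold scaledBessel
  fun_prop

/-- The substitution `w = v / x` in the Bessel integral. -/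
lemma scaledBessel_eq_integral {d : ℕ} (hd : 1 ≤ d) (γ : Fin (d - 1) → ℕ) {x : ℝ} (hx : 0 < x) :
    scaledBessel d γ x = 1 / (2 * π) *
      ∫ v, (Set.Ioc (-π * x) (π * x)).indicator
        (fun v => Real.exp (-(2 * x ^ 2 * cosDefect γ (v / x)))) v := by
  have hle : -π * x ≤ π * x := by nlinarith [Real.pi_pos]
  rw [integral_indicator measurableSet_Ioc, ← intervalIntegral.integral_of_le hle,
    intervalIntegral.integral_comp_div (fun w => Real.exp (-(2 * x ^ 2 * cosDefect γ w))) hx.ne',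
    mul_div_cancel_right₀ _ hx.ne', mul_div_cancel_right₀ _ hx.ne', smul_eq_mul, scaledBessel,
    I0Gamma]
  have key : Real.exp (-(2 * d) * x ^ 2) *
        ∫ w in (-π)..π, Real.exp (2 * x ^ 2 * (Real.cos w + ∑ i, Real.cos (γ i * w)))
      = ∫ w in (-π)..π, Real.exp (-(2 * x ^ 2 * cosDefect γ w)) := by
    rw [← intervalIntegral.integral_const_mul]
    refine intervalIntegral.integral_congr fun w _ => ?_
    simp only [← Real.exp_add, cosDefect, Finset.sum_sub_distrib, Finset.sum_const,
      Finset.card_univ, Fintype.card_fin, nsmul_eq_mul, mul_one, Nat.cast_sub hd, Nat.cast_one]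
    congr 1
    ring
  rw [← key]
  ring

lemma indicator_exp_neg_cosDefect_le {ι : Type*} [Fintype ι] (γ : ι → ℕ) {x : ℝ} (hx : 0 < x)
    (v : ℝ) :
    ‖(Set.Ioc (-π * x) (π * x)).indicator
        (fun v => Real.exp (-(2 * x ^ 2 * cosDefect γ (v / x)))) v‖
      ≤ Real.exp (-(4 / π ^ 2) * v ^ 2) := by
  rw [Set.indicator_apply]
  split_ifs with hv
  · rw [Real.norm_eq_abs, Real.abs_exp, Real.exp_le_exp]
    have hw : |v / x| ≤ π := by
      rw [abs_div, abs_of_pos hx, div_le_iff₀ hx, abs_le]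
      exact ⟨by linarith [hv.1], hv.2⟩
    have h := mul_le_mul_of_nonneg_left (le_cosDefect γ hw) (by positivity : 0 ≤ 2 * x ^ 2)
    have e : 2 * x ^ 2 * (2 / π ^ 2 * (v / x) ^ 2) = 4 / π ^ 2 * v ^ 2 := by
      field_simp
      ring
    linarith
  · simpa using (Real.exp_pos _).le

lemma exists_norm_scaledBessel_le {d : ℕ} (hd : 1 ≤ d) (γ : Fin (d - 1) → ℕ) :
    ∃ C : ℝ, ∀ x : ℝ, 0 < x → ‖scaledBessel d γ x‖ ≤ C := by
  refine ⟨1 / (2 * π) * ∫ v : ℝ, Real.exp (-(4 / π ^ 2) * v ^ 2), fun x hx => ?_⟩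
  rw [scaledBessel_eq_integral hd γ hx, norm_mul, Real.norm_of_nonneg (by positivity)]
  refine mul_le_mul_of_nonneg_left ?_ (by positivity)
  exact norm_integral_le_of_norm_le (integrable_exp_neg_mul_sq (by positivity))
    (Eventually.of_forall (indicator_exp_neg_cosDefect_le γ hx))

/-- Laplace's method for the Bessel integral. -/
lemma tendsto_scaledBessel_atTop {d : ℕ} (hd : 1 ≤ d) (γ : Fin (d - 1) → ℕ) :
    Tendsto (scaledBessel d γ) atTop
      (nhds (1 / (2 * π) * √(π / (1 + ∑ i, (γ i : ℝ) ^ 2)))) := by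
  have hlim : Tendsto (fun x : ℝ => ∫ v, (Set.Ioc (-π * x) (π * x)).indicator
        (fun v => Real.exp (-(2 * x ^ 2 * cosDefect γ (v / x)))) v) atTop
      (nhds (∫ v : ℝ, Real.exp (-(1 + ∑ i, (γ i : ℝ) ^ 2) * v ^ 2))) := by
    refine tendsto_integral_filter_of_dominated_convergence
      (fun v => Real.exp (-(4 / π ^ 2) * v ^ 2)) ?_ ?_
      (integrable_exp_neg_mul_sq (by positivity)) ?_
    · refine Eventually.of_forall fun x => ?_
      have := continuous_cosDefect γ
      have hc : Continuous fun v : ℝ => Real.exp (-(2 * x ^ 2 * cosDefect γ (v / x))) := by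
        fun_prop
      exact hc.aestronglyMeasurable.indicator measurableSet_Ioc
    · filter_upwards [eventually_gt_atTop 0] with x hx
      exact Eventually.of_forall (indicator_exp_neg_cosDefect_le γ hx)
    · refine Eventually.of_forall fun v => ?_
      have h := (Real.continuous_exp.tendsto _).comp (tendsto_sq_mul_cosDefect_atTop γ v).neg
      rw [← neg_mul] at h
      refine h.congr' ?_
      filter_upwards [eventually_gt_atTop (|v| / π)] with x hx
      rw [div_lt_iff₀ Real.pi_pos] at hx
      have hv := abs_lt.1 hx
      have hmem : v ∈ Set.Ioc (-π * x) (π * x) := ⟨by linarith [hv.1], by linarith [hv.2]⟩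
      rw [Set.indicator_of_mem hmem]
      rfl
  rw [integral_gaussian] at hlim
  refine (hlim.const_mul (1 / (2 * π))).congr' ?_
  filter_upwards [eventually_gt_atTop 0] with x hx
  exact (scaledBessel_eq_integral hd γ hx).symm

lemma integrand_eq_scaledBessel (d : ℕ) (γ : Fin (d - 1) → ℕ) (x : ℝ) {t : ℝ} (ht : 0 < t) :
    x * Real.exp (-(2 * d) * x ^ 2 * t) * I0Gamma d γ (2 * x ^ 2 * t) / t
      = scaledBessel d γ (x * √t) * t ^ (-(3 / 2) : ℝ) := by
  have e : (x * √t) ^ 2 = x ^ 2 * t := by rw [mul_pow, Real.sq_sqrt ht.le]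
  have ht' : t ^ (-(3 / 2) : ℝ) = (√t * t)⁻¹ := by
    rw [Real.rpow_neg ht.le, Real.sqrt_eq_rpow, ← Real.rpow_add_one ht.ne']
    norm_num
  have hs : √t ≠ 0 := (Real.sqrt_pos.2 ht).ne'
  rw [scaledBessel, e, ht', ← mul_assoc, ← mul_assoc]
  field_simp

theorem bessel_integral_limit_large (d : ℕ) (hd : 1 ≤ d)
    (γ : Fin (d - 1) → ℕ) (hγ : ∀ i, 1 ≤ γ i) (hmono : Monotone γ) :
    Tendsto (fun n : ℕ =>
        ∫ t in Set.Ioi (1 : ℝ),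
          (n : ℝ) * Real.exp (-(2 * d) * n ^ 2 * t) * I0Gamma d γ (2 * n ^ 2 * t) / t)
      atTop
      (nhds (1 / Real.sqrt (π * (1 + ∑ i, (γ i : ℝ) ^ 2)))) := by
  set c : ℝ := 1 + ∑ i, (γ i : ℝ) ^ 2 with hc
  have hcpos : 0 < c := by positivity
  obtain ⟨C, hC⟩ := exists_norm_scaledBessel_le hd γ
  have hpow : IntegrableOn (fun t : ℝ => t ^ (-(3 / 2) : ℝ)) (Set.Ioi 1) :=
    integrableOn_Ioi_rpow_of_lt (by norm_num) one_pos
  have hlim : Tendsto (fun n : ℕ => ∫ t in Set.Ioi (1 : ℝ),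
        scaledBessel d γ (n * √t) * t ^ (-(3 / 2) : ℝ)) atTop
      (nhds (∫ t in Set.Ioi (1 : ℝ), 1 / (2 * π) * √(π / c) * t ^ (-(3 / 2) : ℝ))) := by
    refine tendsto_integral_filter_of_dominated_convergence
      (fun t => C * t ^ (-(3 / 2) : ℝ)) ?_ ?_ (hpow.const_mul C) ?_
    · refine Eventually.of_forall fun n => ?_
      have := continuous_scaledBessel d γ
      have h : Continuous fun t : ℝ => scaledBessel d γ (n * √t) := by fun_prop
      exact h.aestronglyMeasurable.mul hpow.aestronglyMeasurable
    · filter_upwards [eventually_gt_atTop 0] with n hn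
      filter_upwards [ae_restrict_mem measurableSet_Ioi] with t ht
      have ht0 : (0 : ℝ) < t := one_pos.trans ht
      have hn' : (0 : ℝ) < n := Nat.cast_pos.2 hn
      rw [norm_mul, Real.norm_of_nonneg (Real.rpow_nonneg ht0.le _)]
      exact mul_le_mul_of_nonneg_right (hC _ (by positivity)) (Real.rpow_nonneg ht0.le _)
    · filter_upwards [ae_restrict_mem measurableSet_Ioi] with t ht
      have ht0 : (0 : ℝ) < t := one_pos.trans ht
      exact ((tendsto_scaledBessel_atTop hd γ).comp
        (tendsto_natCast_atTop_atTop.atTop_mul_const (Real.sqrt_pos.2 ht0))).mul_const _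
  have hval : ∫ t in Set.Ioi (1 : ℝ), 1 / (2 * π) * √(π / c) * t ^ (-(3 / 2) : ℝ)
      = 1 / √(π * c) := by
    rw [integral_const_mul, integral_Ioi_rpow_of_lt (by norm_num) one_pos, Real.one_rpow,
      Real.sqrt_div Real.pi_pos.le, Real.sqrt_mul Real.pi_pos.le]
    have h1 : √π ≠ 0 := (Real.sqrt_pos.2 Real.pi_pos).ne'
    have h2 : √c ≠ 0 := (Real.sqrt_pos.2 hcpos).ne'
    have h3 := Real.sq_sqrt Real.pi_pos.le
    have h4 := Real.pi_ne_zero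
    field_simp
    rw [h3]
    norm_num
  rw [hval] at hlim
  refine hlim.congr fun n => setIntegral_congr_fun measurableSet_Ioi fun t ht => ?_
  exact (integrand_eq_scaledBessel d γ n (one_pos.trans ht)).symm
end

section
/- Let (a_n) be a sequence of positive integers with a_n/n → 0 as n → ∞. Then lim_{n→∞} ∫_0^1 (θ_{Λ_n}(n²t) − det(Λ_n)·e^{−2dn²t}·I_0(2n²t)^{d−p}·∑_{(k_1,…,k_p)∈ℤ^p} ∏_{i=1}^p I_{k_i α_i a_n}(2n²t)) dt/t = ∫_0^1 (Θ_B(t) − det(B)·(4πt)^{−(d−p)/2}) dt/t, where det(Λ_n) = a_n^p·n^{d−p}·α_1⋯α_p·β_1⋯β_{d−p} and det(B) = β_1⋯β_{d−p}. -/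
open Real MeasureTheory Filter Finset

/-- Eigenvalues of the combinatorial Laplacian on the discrete torus
`ℤ^d/Λ_n ℤ^d`, `Λ_n = diag(α_1 a_n, …, α_p a_n, β_1 n, …, β_{d-p} n)`. -/
noncomputable def torusLam (d p : ℕ) (α : Fin p → ℕ) (β : Fin (d - p) → ℕ) (a n : ℕ)
    (x : ((i : Fin p) → Fin (α i * a)) × ((i : Fin (d - p)) → Fin (β i * n))) : ℝ :=
  2 * d - 2 * ∑ i, Real.cos (2 * π * (x.1 i : ℕ) / (α i * a))
        - 2 * ∑ i, Real.cos (2 * π * (x.2 i : ℕ) / (β i * n))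

/-- Theta function of the discrete torus `ℤ^d/Λ_n ℤ^d`. -/
noncomputable def torusTheta (d p : ℕ) (α : Fin p → ℕ) (β : Fin (d - p) → ℕ)
    (a n : ℕ) (t : ℝ) : ℝ :=
  ∑ x : ((i : Fin p) → Fin (α i * a)) × ((i : Fin (d - p)) → Fin (β i * n)),
    Real.exp (-(torusLam d p α β a n x) * t)

/-- Theta function of the real torus `ℝ^{d-p}/Bℤ^{d-p}`, `B = diag(β_1, …, β_{d-p})`. -/
noncomputable def ThetaB (d p : ℕ) (β : Fin (d - p) → ℕ) (t : ℝ) : ℝ :=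
  ∑' k : Fin (d - p) → ℤ, Real.exp (-4 * π ^ 2 * t * ∑ i, (k i : ℝ) ^ 2 / (β i : ℝ) ^ 2)

lemma besselI_eq_integral_zero_two_pi (m : ℤ) (t : ℝ) :
    besselI m t =
      (1 / (2 * π)) * ∫ θ in (0 : ℝ)..(2 * π), Real.exp (t * Real.cos θ) * Real.cos (m * θ) := by
  have hper : Function.Periodic
      (fun θ : ℝ => Real.exp (t * Real.cos θ) * Real.cos (m * θ)) (2 * π) := by
    intro θ
    have h : (m : ℝ) * (θ + 2 * π) = m * θ + m * (2 * π) := by ring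
    simp only [Real.cos_add_two_pi, h, Real.cos_add_int_mul_two_pi]
  have h := hper.intervalIntegral_add_eq (-π) 0
  rw [show -π + 2 * π = π by ring, zero_add] at h
  rw [besselI, h]

/-- The function whose average over any circle around `0` is the `m`-th Bessel coefficient. -/
noncomputable def besselKernel (m : ℤ) (t : ℝ) (z : ℂ) : ℂ :=
  Complex.exp ((t / 2 : ℂ) * (z + z⁻¹)) * z ^ (-m)

lemma differentiableAt_besselKernel (m : ℤ) (t : ℝ) {z : ℂ} (hz : z ≠ 0) :
    DifferentiableAt ℂ (besselKernel m t) z := by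
  unfold besselKernel
  refine DifferentiableAt.mul ?_ (differentiableAt_zpow.2 (Or.inl hz))
  exact (((differentiableAt_id).add (differentiableAt_inv hz)).const_mul _).cexp

lemma integral_besselKernel_circleMap_eq (m : ℤ) (t : ℝ) {r R : ℝ} (hr : 0 < r) (hle : r ≤ R) :
    (∫ θ in (0 : ℝ)..(2 * π), besselKernel m t (circleMap 0 R θ)) =
      ∫ θ in (0 : ℝ)..(2 * π), besselKernel m t (circleMap 0 r θ) := by
  have key := Complex.circleIntegral_sub_center_inv_smul_eq_of_differentiable_on_annulus_off_countable
    (c := 0) hr hle (f := besselKernel m t) Set.countable_empty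
    (fun z hz => (differentiableAt_besselKernel m t (by
      rintro rfl
      exact hz.2 (by simpa using hr))).continuousAt.continuousWithinAt)
    (fun z hz => differentiableAt_besselKernel m t (by
      rintro rfl
      exact hz.1.2 (by simpa using hr.le)))
  have h : ∀ ρ : ℝ, 0 < ρ → (∮ z in C(0, ρ), (z - 0)⁻¹ • besselKernel m t z) =
      Complex.I * ∫ θ in (0 : ℝ)..(2 * π), besselKernel m t (circleMap 0 ρ θ) := by
    intro ρ hρ
    rw [circleIntegral, ← intervalIntegral.integral_const_mul]
    refine intervalIntegral.integral_congr fun θ _ => ?_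
    have hne : circleMap 0 ρ θ ≠ 0 := circleMap_ne_center hρ.ne'
    simp only [deriv_circleMap, sub_zero, smul_eq_mul]
    field_simp
  rw [h R (hr.trans_le hle), h r hr] at key
  exact mul_left_cancel₀ Complex.I_ne_zero key

lemma norm_besselKernel_circleMap (m : ℤ) (t y θ : ℝ) :
    ‖besselKernel m t (circleMap 0 (Real.exp y) θ)‖ =
      Real.exp (-(m * y)) * Real.exp (t * Real.cosh y * Real.cos θ) := by
  have hz : circleMap 0 (Real.exp y) θ = Complex.exp (y + θ * Complex.I) := by
    simp [circleMap, Complex.exp_add]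
  rw [hz, besselKernel, norm_mul, ← Complex.exp_neg, ← Complex.exp_int_mul, Complex.norm_exp,
    Complex.norm_exp, mul_comm]
  congr 1
  · congr 1
    simp
  · congr 1
    have : ((t : ℂ) / 2) = ((t / 2 : ℝ) : ℂ) := by push_cast; ring
    rw [this, Complex.re_ofReal_mul, Complex.add_re, Complex.exp_re, Complex.exp_re, Real.cosh_eq]
    simp
    ring

lemma norm_integral_besselKernel_le (m : ℤ) (t y : ℝ) :
    ‖(1 / (2 * π) : ℂ) * ∫ θ in (0 : ℝ)..(2 * π), besselKernel m t (circleMap 0 1 θ)‖ ≤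
      Real.exp (-(m * y)) * besselI 0 (t * Real.cosh y) := by
  have h1 : (∫ θ in (0 : ℝ)..(2 * π), besselKernel m t (circleMap 0 1 θ)) =
      ∫ θ in (0 : ℝ)..(2 * π), besselKernel m t (circleMap 0 (Real.exp y) θ) := by
    rcases le_total 1 (Real.exp y) with h | h
    · exact (integral_besselKernel_circleMap_eq m t one_pos h).symm
    · exact integral_besselKernel_circleMap_eq m t (Real.exp_pos y) h
  rw [h1, besselI_eq_integral_zero_two_pi, norm_mul]
  have h2 := intervalIntegral.norm_integral_le_integral_norm (μ := volume)
    (f := fun θ => besselKernel m t (circleMap 0 (Real.exp y) θ)) Real.two_pi_pos.le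
  simp only [norm_besselKernel_circleMap, intervalIntegral.integral_const_mul] at h2
  have h3 : ‖(1 / (2 * π) : ℂ)‖ = 1 / (2 * π) := by
    rw [show (1 / (2 * π) : ℂ) = ((1 / (2 * π) : ℝ) : ℂ) by push_cast; ring, Complex.norm_real,
      Real.norm_of_nonneg (by positivity)]
  rw [h3]
  calc _ ≤ 1 / (2 * π) * (Real.exp (-(m * y)) *
        ∫ θ in (0 : ℝ)..(2 * π), Real.exp (t * Real.cosh y * Real.cos θ)) := by gcongr
    _ = _ := by simp; ring

/-- `θ ↦ exp (t cos θ)` as a continuous function on the circle of length `2 * π`. -/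
noncomputable def expCosCircle (t : ℝ) : C(AddCircle (2 * π), ℂ) where
  toFun x := Complex.exp ((t * Real.Angle.cos x : ℝ) : ℂ)
  continuous_toFun := by
    have := Real.Angle.continuous_cos
    exact Complex.continuous_exp.comp
      (Complex.continuous_ofReal.comp (continuous_const.mul this))

instance fact_zero_lt_two_pi : Fact (0 < 2 * π) := ⟨Real.two_pi_pos⟩

lemma fourier_two_pi_coe (m : ℤ) (θ : ℝ) :
    (fourier m (θ : AddCircle (2 * π)) : ℂ) = Complex.exp ((m * θ : ℝ) * Complex.I) := by
  rw [fourier_coe_apply]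
  congr 1
  have : (π : ℂ) ≠ 0 := by exact_mod_cast Real.pi_ne_zero
  push_cast
  field_simp

lemma fourierCoeff_expCosCircle (m : ℤ) (t : ℝ) :
    fourierCoeff (expCosCircle t) m =
      (1 / (2 * π) : ℂ) * ∫ θ in (0 : ℝ)..(2 * π), besselKernel m t (circleMap 0 1 θ) := by
  rw [fourierCoeff_eq_intervalIntegral _ _ 0, zero_add, Complex.real_smul]
  congr 1
  · push_cast; ring
  · refine intervalIntegral.integral_congr fun θ _ => ?_
    have hz : circleMap 0 1 θ = Complex.exp (θ * Complex.I) := by simp [circleMap]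
    simp only [besselKernel, hz, fourier_two_pi_coe, ← Complex.exp_int_mul, ← Complex.exp_neg,
      expCosCircle, ContinuousMap.coe_mk, smul_eq_mul]
    rw [mul_comm]
    congr 2
    · have : Real.Angle.cos (θ : AddCircle (2 * π)) = Real.cos θ := Real.Angle.cos_coe θ
      rw [this]
      push_cast
      rw [Complex.cos]
      ring_nf
    · push_cast; ring

lemma re_fourierCoeff_expCosCircle (m : ℤ) (t : ℝ) :
    (fourierCoeff (expCosCircle t) m).re = besselI m t := by
  rw [fourierCoeff_eq_intervalIntegral _ _ 0, zero_add, Complex.smul_re, smul_eq_mul,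
    besselI_eq_integral_zero_two_pi]
  congr 1
  have hcont : Continuous fun θ : ℝ =>
      (fourier (-m) (θ : AddCircle (2 * π)) : ℂ) • expCosCircle t θ := by
    simp only [fourier_two_pi_coe]
    have : Continuous fun θ : ℝ => expCosCircle t (θ : AddCircle (2 * π)) :=
      (expCosCircle t).continuous.comp (AddCircle.continuous_mk' _)
    fun_prop
  have h := Complex.reCLM.intervalIntegral_comp_comm (μ := volume) (hcont.intervalIntegrable 0 (2 * π))
  simp only [Complex.reCLM_apply] at h
  rw [← h]
  refine intervalIntegral.integral_congr fun θ _ => ?_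
  have : Real.Angle.cos (θ : AddCircle (2 * π)) = Real.cos θ := Real.Angle.cos_coe θ
  simp only [fourier_two_pi_coe, expCosCircle, ContinuousMap.coe_mk, smul_eq_mul, this,
    ← Complex.ofReal_exp]
  rw [mul_comm, Complex.re_ofReal_mul, Complex.exp_ofReal_mul_I_re]
  simp

lemma norm_fourierCoeff_expCosCircle_le (m : ℤ) (t y : ℝ) :
    ‖fourierCoeff (expCosCircle t) m‖ ≤ Real.exp (-(|m| * y)) * besselI 0 (t * Real.cosh y) := by
  rw [fourierCoeff_expCosCircle]
  rcases abs_choice m with h | h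
  · rw [h]
    exact norm_integral_besselKernel_le m t y
  · rw [h]
    simpa using norm_integral_besselKernel_le m t (-y)

lemma abs_besselI_le (m : ℤ) (t y : ℝ) :
    |besselI m t| ≤ Real.exp (-(|m| * y)) * besselI 0 (t * Real.cosh y) := by
  rw [← re_fourierCoeff_expCosCircle]
  exact (Complex.abs_re_le_norm _).trans (norm_fourierCoeff_expCosCircle_le m t y)

lemma summable_exp_neg_abs {x : ℝ} (hx : 0 < x) :
    Summable fun k : ℤ => Real.exp (-(|(k : ℝ)| * x)) := by
  have h : Summable fun n : ℕ => Real.exp (-((n : ℝ) * x)) := by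
    simpa [mul_comm] using Real.summable_exp_nat_mul_iff.2 (neg_lt_zero.2 hx)
  exact Summable.of_nat_of_neg (by simpa using h) (by simpa using h)

lemma summable_fourierCoeff_expCosCircle (t : ℝ) :
    Summable (fourierCoeff (expCosCircle t)) := by
  refine Summable.of_norm_bounded
    ((summable_exp_neg_abs one_pos).mul_right (besselI 0 (t * Real.cosh 1))) fun m => ?_
  simpa using norm_fourierCoeff_expCosCircle_le m t 1

lemma hasSum_fourierCoeff_mul_exp (t θ : ℝ) :
    HasSum (fun m : ℤ => fourierCoeff (expCosCircle t) m * Complex.exp ((m * θ : ℝ) * Complex.I))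
      (Complex.exp ((t * Real.cos θ : ℝ) : ℂ)) := by
  have h := has_pointwise_sum_fourier_series_of_summable
    (summable_fourierCoeff_expCosCircle t) (θ : AddCircle (2 * π))
  have hc : Real.Angle.cos (θ : AddCircle (2 * π)) = Real.cos θ := Real.Angle.cos_coe θ
  simp only [fourier_two_pi_coe, smul_eq_mul] at h
  have h' : (expCosCircle t) (θ : AddCircle (2 * π)) =
      Complex.exp ((t * Real.cos θ : ℝ) : ℂ) := by
    simp only [expCosCircle, ContinuousMap.coe_mk, hc]
  rwa [h'] at h
lemma sum_exp_two_pi_mul_div (m : ℤ) {N : ℕ} (hN : 0 < N) :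
    ∑ j ∈ Finset.range N, Complex.exp ((m * (2 * π * j / N) : ℝ) * Complex.I) =
      if (N : ℤ) ∣ m then (N : ℂ) else 0 := by
  have hN' : (N : ℂ) ≠ 0 := by exact_mod_cast hN.ne'
  have hprim := Complex.isPrimitiveRoot_exp N hN.ne'
  set ζ := Complex.exp (2 * π * Complex.I / N)
  have h : ∀ j ∈ Finset.range N,
      Complex.exp ((m * (2 * π * j / N) : ℝ) * Complex.I) = (ζ ^ m) ^ j := by
    intro j _
    rw [← Complex.exp_int_mul, ← Complex.exp_nat_mul]
    congr 1
    push_cast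
    field_simp
  rw [Finset.sum_congr rfl h]
  split_ifs with hd
  · rw [(hprim.zpow_eq_one_iff_dvd m).2 hd]
    simp
  · rw [geom_sum_eq (fun h1 => hd ((hprim.zpow_eq_one_iff_dvd m).1 h1)), ← zpow_natCast,
      ← zpow_mul, mul_comm, zpow_mul, zpow_natCast, hprim.pow_eq_one]
    simp

lemma hasSum_besselI_mul {N : ℕ} (hN : 0 < N) (t : ℝ) :
    HasSum (fun k : ℤ => N * besselI (k * N) t)
      (∑ j ∈ Finset.range N, Real.exp (t * Real.cos (2 * π * j / N))) := by
  have h1 := hasSum_sum (s := Finset.range N)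
    fun j _ => hasSum_fourierCoeff_mul_exp t (2 * π * j / N)
  simp only [← Finset.mul_sum, sum_exp_two_pi_mul_div _ hN] at h1
  have hinj : Function.Injective fun k : ℤ => k * (N : ℤ) :=
    mul_left_injective₀ (by exact_mod_cast hN.ne')
  rw [← hinj.hasSum_iff] at h1
  · have h2 := Complex.hasSum_re h1
    convert h2 using 1
    · ext k
      simp only [Function.comp_apply, dvd_mul_left, if_true]
      rw [mul_comm _ (N : ℂ), ← Complex.ofReal_natCast, Complex.re_ofReal_mul,
        re_fourierCoeff_expCosCircle]
    · rw [Complex.re_sum]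
      exact Finset.sum_congr rfl fun j _ => by rw [Complex.exp_ofReal_re]
  · intro m hm
    rw [if_neg, mul_zero]
    rintro ⟨k, rfl⟩
    exact hm ⟨k, mul_comm _ _⟩

/-- The theta function of the discrete circle `ℤ/Nℤ`. -/
noncomputable def circleTheta (N : ℕ) (s : ℝ) : ℝ :=
  ∑ j ∈ Finset.range N, Real.exp (-(2 * s * (1 - Real.cos (2 * π * j / N))))

lemma hasSum_circleTheta {N : ℕ} (hN : 0 < N) (s : ℝ) :
    HasSum (fun k : ℤ => N * Real.exp (-(2 * s)) * besselI (k * N) (2 * s))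
      (circleTheta N s) := by
  have h := (hasSum_besselI_mul hN (2 * s)).mul_left (Real.exp (-(2 * s)))
  have h1 : Real.exp (-(2 * s)) * ∑ j ∈ Finset.range N,
      Real.exp (2 * s * Real.cos (2 * π * j / N)) = circleTheta N s := by
    rw [Finset.mul_sum, circleTheta]
    refine Finset.sum_congr rfl fun j _ => ?_
    rw [← Real.exp_add]
    ring_nf
  rw [h1] at h
  simpa only [mul_left_comm, mul_assoc] using h

lemma continuous_circleTheta (N : ℕ) : Continuous (circleTheta N) := by
  unfold circleTheta
  fun_prop

lemma circleTheta_nonneg (N : ℕ) (s : ℝ) : 0 ≤ circleTheta N s :=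
  Finset.sum_nonneg fun _ _ => (Real.exp_pos _).le

lemma one_le_circleTheta {N : ℕ} (hN : 0 < N) (s : ℝ) : 1 ≤ circleTheta N s := by
  have h := Finset.single_le_sum
    (f := fun j : ℕ => Real.exp (-(2 * s * (1 - Real.cos (2 * π * j / N)))))
    (fun _ _ => (Real.exp_pos _).le) (Finset.mem_range.2 hN)
  simpa [circleTheta] using h

lemma hasSum_exp_neg_abs {x : ℝ} (hx : 0 < x) :
    HasSum (fun k : ℤ => Real.exp (-(|(k : ℝ)| * x))) (1 + 2 / (Real.exp x - 1)) := by
  have hlt : Real.exp (-x) < 1 := by simpa using hx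
  have hg := hasSum_geometric_of_lt_one (Real.exp_pos (-x)).le hlt
  have h1 : ∀ n : ℕ, Real.exp (-(|((n : ℤ) : ℝ)| * x)) = Real.exp (-x) ^ n := by
    intro n
    rw [← Real.exp_nat_mul]
    simp
  have h2 : ∀ n : ℕ, Real.exp (-(|((-(n + 1 : ℤ) : ℤ) : ℝ)| * x)) =
      Real.exp (-x) * Real.exp (-x) ^ n := by
    intro n
    have h : |((-(n + 1 : ℤ) : ℤ) : ℝ)| = n + 1 := by
      push_cast
      rw [abs_neg, abs_of_nonneg (by positivity)]
    rw [← Real.exp_nat_mul, ← Real.exp_add, h]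
    ring_nf
  have h := HasSum.of_nat_of_neg_add_one (f := fun k : ℤ => Real.exp (-(|(k : ℝ)| * x)))
    (by simpa only [h1] using hg) (by simpa only [h2] using hg.mul_left (Real.exp (-x)))
  have h3 : 1 < Real.exp x := Real.one_lt_exp_iff.2 hx
  have h4 : Real.exp x - 1 ≠ 0 := by linarith
  have h5 : (1 - Real.exp (-x))⁻¹ + Real.exp (-x) * (1 - Real.exp (-x))⁻¹ =
      1 + 2 / (Real.exp x - 1) := by
    rw [Real.exp_neg]
    field_simp
    ring
  rwa [h5] at h

lemma exp_neg_mul_sq_le {x : ℝ} (hx : 0 < x) (k : ℤ) :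
    Real.exp (-(x * (k : ℝ) ^ 2)) ≤ Real.exp (-(|(k : ℝ)| * x)) := by
  have h : |(k : ℝ)| ≤ (k : ℝ) ^ 2 := by
    have : |k| ≤ k ^ 2 := by
      rw [← sq_abs]
      exact Int.le_self_sq _
    exact_mod_cast this
  rw [Real.exp_le_exp]
  nlinarith

lemma summable_exp_neg_mul_sq {x : ℝ} (hx : 0 < x) :
    Summable fun k : ℤ => Real.exp (-(x * (k : ℝ) ^ 2)) :=
  Summable.of_nonneg_of_le (fun _ => (Real.exp_pos _).le) (exp_neg_mul_sq_le hx)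
    (hasSum_exp_neg_abs hx).summable

lemma tsum_exp_neg_mul_sq_le {x : ℝ} (hx : 0 < x) :
    ∑' k : ℤ, Real.exp (-(x * (k : ℝ) ^ 2)) ≤ 1 + 2 / x := by
  refine ((summable_exp_neg_mul_sq hx).tsum_le_tsum (exp_neg_mul_sq_le hx)
    (hasSum_exp_neg_abs hx).summable).trans ?_
  rw [(hasSum_exp_neg_abs hx).tsum_eq]
  have := Real.add_one_le_exp x
  gcongr
  linarith

lemma circleTheta_eq_tsum {N : ℕ} (hN : 0 < N) (s : ℝ) :
    circleTheta N s = ∑' k : ℤ, if -(N : ℤ) < 2 * k ∧ 2 * k ≤ N then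
      Real.exp (-(2 * s * (1 - Real.cos (2 * π * k / N)))) else 0 := by
  have hN' : (N : ℝ) ≠ 0 := by exact_mod_cast hN.ne'
  rw [tsum_eq_sum (s := (Finset.Icc (-(N : ℤ)) N).filter
    fun k => -(N : ℤ) < 2 * k ∧ 2 * k ≤ N)]
  · rw [Finset.sum_congr rfl fun k hk => if_pos (Finset.mem_filter.1 hk).2]
    refine Finset.sum_nbij' (fun j : ℕ => if 2 * j ≤ N then (j : ℤ) else j - N)
      (fun k : ℤ => if 0 ≤ k then k.toNat else (k + N).toNat) ?_ ?_ ?_ ?_ ?_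
    · intro j hj
      have := Finset.mem_range.1 hj
      simp only [Finset.mem_filter, Finset.mem_Icc]
      split_ifs <;> omega
    · intro k hk
      simp only [Finset.mem_filter, Finset.mem_Icc] at hk
      simp only [Finset.mem_range]
      split_ifs <;> omega
    · intro j hj
      have := Finset.mem_range.1 hj
      split_ifs <;> omega
    · intro k hk
      simp only [Finset.mem_filter, Finset.mem_Icc] at hk
      split_ifs <;> omega
    · intro j _
      split_ifs
      · simp
      · have : 2 * π * (((j : ℤ) - N : ℤ) : ℝ) / N = 2 * π * j / N - 2 * π := by
          push_cast
          field_simp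
        rw [this, Real.cos_sub_two_pi]
  · intro k hk
    rw [if_neg]
    intro h
    apply hk
    simp only [Finset.mem_filter, Finset.mem_Icc]
    omega

lemma window_exp_le {N : ℕ} (hN : 0 < N) {s : ℝ} (hs : 0 ≤ s) (k : ℤ) :
    (if -(N : ℤ) < 2 * k ∧ 2 * k ≤ N then
      Real.exp (-(2 * s * (1 - Real.cos (2 * π * k / N)))) else 0) ≤
      Real.exp (-(16 * s / (N : ℝ) ^ 2 * (k : ℝ) ^ 2)) := by
  have hN' : (0 : ℝ) < N := by exact_mod_cast hN
  split_ifs with h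
  · have h1 : |2 * π * (k : ℝ) / N| ≤ π := by
      have h2 : -(N : ℝ) ≤ 2 * k := by exact_mod_cast h.1.le
      have h3 : 2 * (k : ℝ) ≤ N := by exact_mod_cast h.2
      rw [abs_le]
      constructor
      · rw [le_div_iff₀ hN']; nlinarith [Real.pi_pos]
      · rw [div_le_iff₀ hN']; nlinarith [Real.pi_pos]
    have h2 := Real.cos_le_one_sub_mul_cos_sq h1
    rw [Real.exp_le_exp, neg_le_neg_iff]
    have h3 : 2 / π ^ 2 * (2 * π * (k : ℝ) / N) ^ 2 = 8 / (N : ℝ) ^ 2 * (k : ℝ) ^ 2 := by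
      field_simp
      ring
    rw [h3] at h2
    calc 16 * s / (N : ℝ) ^ 2 * (k : ℝ) ^ 2 = 2 * s * (8 / (N : ℝ) ^ 2 * (k : ℝ) ^ 2) := by ring
      _ ≤ _ := by gcongr; linarith
  · exact (Real.exp_pos _).le

lemma circleTheta_le {N : ℕ} (hN : 0 < N) {s : ℝ} (hs : 0 < s) :
    circleTheta N s ≤ 1 + (N : ℝ) ^ 2 / (8 * s) := by
  have hN' : (0 : ℝ) < N := by exact_mod_cast hN
  have hx : 0 < 16 * s / (N : ℝ) ^ 2 := by positivity
  rw [circleTheta_eq_tsum hN]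
  have hsum := summable_exp_neg_mul_sq hx
  refine (Summable.tsum_le_tsum (window_exp_le hN hs.le)
    (Summable.of_nonneg_of_le (fun k => ?_) (window_exp_le hN hs.le) hsum) hsum).trans ?_
  · split_ifs
    exacts [(Real.exp_pos _).le, le_rfl]
  · refine (tsum_exp_neg_mul_sq_le hx).trans (le_of_eq ?_)
    field_simp
    ring
lemma one_sub_cos_eq_sinc (x : ℝ) : 1 - Real.cos x = x ^ 2 / 2 * Real.sinc (x / 2) ^ 2 := by
  have h1 : Real.sin (x / 2) = x / 2 * Real.sinc (x / 2) := by
    by_cases h : x / 2 = 0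
    · simp [h]
    · rw [Real.sinc_of_ne_zero h, mul_div_cancel₀ _ h]
  have h2 := Real.cos_two_mul (x / 2)
  rw [show 2 * (x / 2) = x by ring] at h2
  have h3 := Real.sin_sq_add_cos_sq (x / 2)
  rw [h1] at h3
  linear_combination -h2 - 2 * h3

lemma tendsto_mul_one_sub_cos {ι : Type*} {l : Filter ι} {w x : ι → ℝ} {c : ℝ}
    (hx : Tendsto x l (nhds 0)) (h : Tendsto (fun i => w i * x i ^ 2) l (nhds c)) :
    Tendsto (fun i => w i * (1 - Real.cos (x i))) l (nhds (c / 2)) := by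
  have h1 : Tendsto (fun i => Real.sinc (x i / 2)) l (nhds 1) := by
    have h0 : Tendsto (fun i => x i / 2) l (nhds 0) := by simpa using hx.div_const 2
    simpa [Function.comp_def] using (Real.continuous_sinc.tendsto 0).comp h0
  have h2 := (h.div_const 2).mul (h1.pow 2)
  rw [one_pow, mul_one] at h2
  refine h2.congr fun i => ?_
  rw [one_sub_cos_eq_sinc]
  ring

lemma continuous_besselI (m : ℤ) : Continuous (besselI m) := by
  unfold besselI
  refine continuous_const.mul
    (intervalIntegral.continuous_parametric_intervalIntegral_of_continuous' ?_ _ _)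
  simp only [Function.uncurry_def]
  fun_prop

lemma exp_neg_mul_besselI_zero (t : ℝ) :
    Real.exp (-t) * besselI 0 t =
      1 / (2 * π) * ∫ θ in (-π)..π, Real.exp (-(t * (1 - Real.cos θ))) := by
  rw [besselI, mul_left_comm, ← intervalIntegral.integral_const_mul]
  congr 1
  refine intervalIntegral.integral_congr fun θ _ => ?_
  simp only [Int.cast_zero, zero_mul, Real.cos_zero, mul_one, ← Real.exp_add]
  ring_nf

lemma besselI_zero_nonneg (t : ℝ) : 0 ≤ besselI 0 t := by
  rw [besselI]
  refine mul_nonneg (by positivity) (intervalIntegral.integral_nonneg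
    (by linarith [Real.pi_pos]) fun θ _ => ?_)
  simpa using (Real.exp_pos _).le

lemma exp_neg_mul_besselI_zero_le_one {t : ℝ} (ht : 0 ≤ t) :
    Real.exp (-t) * besselI 0 t ≤ 1 := by
  rw [exp_neg_mul_besselI_zero]
  have h : (∫ θ in (-π)..π, Real.exp (-(t * (1 - Real.cos θ)))) ≤ ∫ θ in (-π)..π, (1 : ℝ) := by
    refine intervalIntegral.integral_mono_on (by linarith [Real.pi_pos])
      (Continuous.intervalIntegrable (by fun_prop) _ _)
      (Continuous.intervalIntegrable (by fun_prop) _ _) fun θ _ => ?_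
    rw [Real.exp_le_one_iff]
    nlinarith [Real.cos_le_one θ]
  rw [intervalIntegral.integral_const, smul_eq_mul, mul_one] at h
  calc _ ≤ 1 / (2 * π) * (π - -π) := by gcongr
    _ = 1 := by field_simp; ring

lemma sqrt_mul_exp_neg_mul_besselI_zero {t : ℝ} (ht : 0 < t) :
    √t * (Real.exp (-t) * besselI 0 t) =
      1 / (2 * π) * ∫ φ : ℝ, (Set.Ioc (-(π * √t)) (π * √t)).indicator
        (fun φ => Real.exp (-(t * (1 - Real.cos (φ / √t))))) φ := by
  have hs : 0 < √t := Real.sqrt_pos.2 ht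
  rw [exp_neg_mul_besselI_zero, mul_left_comm, integral_indicator measurableSet_Ioc,
    ← intervalIntegral.integral_of_le (by nlinarith [Real.pi_pos])]
  have h := intervalIntegral.integral_comp_div (a := -(π * √t)) (b := π * √t)
    (fun θ => Real.exp (-(t * (1 - Real.cos θ)))) hs.ne'
  rw [h, neg_div, mul_div_cancel_right₀ _ hs.ne', smul_eq_mul]

lemma indicator_exp_le {t : ℝ} (ht : 0 < t) (φ : ℝ) :
    (Set.Ioc (-(π * √t)) (π * √t)).indicator
        (fun φ => Real.exp (-(t * (1 - Real.cos (φ / √t))))) φ ≤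
      Real.exp (-(2 / π ^ 2) * φ ^ 2) := by
  have hs : 0 < √t := Real.sqrt_pos.2 ht
  refine Set.indicator_le' (f := fun φ => Real.exp (-(t * (1 - Real.cos (φ / √t)))))
    (g := fun φ => Real.exp (-(2 / π ^ 2) * φ ^ 2)) (fun φ hφ => ?_)
    (fun φ _ => (Real.exp_pos _).le) φ
  have h1 : |φ / √t| ≤ π := by
    rw [abs_div, abs_of_pos hs, div_le_iff₀ hs, abs_le]
    exact ⟨hφ.1.le, hφ.2⟩
  have h2 := Real.cos_le_one_sub_mul_cos_sq h1
  rw [Real.exp_le_exp, neg_mul, neg_le_neg_iff]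
  calc 2 / π ^ 2 * φ ^ 2 = t * (2 / π ^ 2 * (φ / √t) ^ 2) := by
        rw [div_pow, Real.sq_sqrt ht.le]
        field_simp
    _ ≤ _ := by gcongr; linarith

lemma sqrt_mul_exp_neg_mul_besselI_zero_le_one {t : ℝ} (ht : 0 < t) :
    √t * (Real.exp (-t) * besselI 0 t) ≤ 1 := by
  rw [sqrt_mul_exp_neg_mul_besselI_zero ht]
  have hpos : (0 : ℝ) < 2 / π ^ 2 := by positivity
  have h := integral_mono_of_nonneg (μ := volume)
    (Eventually.of_forall fun φ => Set.indicator_nonneg (fun _ _ => (Real.exp_pos _).le) φ)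
    (integrable_exp_neg_mul_sq hpos) (Eventually.of_forall (indicator_exp_le ht))
  rw [integral_gaussian] at h
  have h2 : √(π / (2 / π ^ 2)) ≤ 2 * π := by
    rw [Real.sqrt_le_left (by positivity)]
    have : π / (2 / π ^ 2) = π ^ 3 / 2 := by field_simp
    rw [this]
    nlinarith [Real.pi_pos, Real.pi_lt_four, sq_nonneg π, mul_pos Real.pi_pos Real.pi_pos]
  calc _ ≤ 1 / (2 * π) * (2 * π) := by gcongr; exact h.trans h2
    _ = 1 := by field_simp

lemma tendsto_sqrt_mul_exp_neg_mul_besselI_zero :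
    Tendsto (fun t : ℝ => √t * (Real.exp (-t) * besselI 0 t)) atTop (nhds (1 / √(2 * π))) := by
  have hlim : 1 / √(2 * π) = 1 / (2 * π) * ∫ φ : ℝ, Real.exp (-(1 / 2) * φ ^ 2) := by
    rw [integral_gaussian, show π / (1 / 2) = 2 * π by ring]
    have h := Real.mul_self_sqrt Real.two_pi_pos.le
    have h0 : 0 < √(2 * π) := Real.sqrt_pos.2 Real.two_pi_pos
    rw [eq_comm, ← h, Real.sqrt_mul_self h0.le]
    field_simp
  rw [hlim]
  have hpos : (0 : ℝ) < 2 / π ^ 2 := by positivity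
  have key : Tendsto (fun t : ℝ => ∫ φ : ℝ, (Set.Ioc (-(π * √t)) (π * √t)).indicator
        (fun φ => Real.exp (-(t * (1 - Real.cos (φ / √t))))) φ) atTop
      (nhds (∫ φ : ℝ, Real.exp (-(1 / 2) * φ ^ 2))) := by
    refine tendsto_integral_filter_of_dominated_convergence
      (fun φ => Real.exp (-(2 / π ^ 2) * φ ^ 2)) ?_ ?_ (integrable_exp_neg_mul_sq hpos) ?_
    · refine Eventually.of_forall fun t => ?_
      refine (Continuous.aestronglyMeasurable ?_).indicator measurableSet_Ioc
      fun_prop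
    · filter_upwards [eventually_gt_atTop 0] with t ht
      refine Eventually.of_forall fun φ => ?_
      rw [Real.norm_of_nonneg (Set.indicator_nonneg (fun _ _ => (Real.exp_pos _).le) φ)]
      exact indicator_exp_le ht φ
    · refine Eventually.of_forall fun φ => ?_
      have hsq : Tendsto (fun t : ℝ => √t) atTop atTop := Real.tendsto_sqrt_atTop
      have h1 : Tendsto (fun t : ℝ => t * (1 - Real.cos (φ / √t))) atTop (nhds (φ ^ 2 / 2)) := by
        refine tendsto_mul_one_sub_cos (tendsto_const_nhds.div_atTop hsq) ?_
        refine tendsto_const_nhds.congr' ?_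
        filter_upwards [eventually_gt_atTop 0] with t ht
        rw [div_pow, Real.sq_sqrt ht.le]
        field_simp
      have h2 := (Real.continuous_exp.tendsto _).comp h1.neg
      rw [show -(φ ^ 2 / 2) = -(1 / 2) * φ ^ 2 by ring] at h2
      refine h2.congr' ?_
      filter_upwards [(hsq.const_mul_atTop Real.pi_pos).eventually_gt_atTop |φ|] with t ht
      rw [Set.indicator_of_mem]
      · rfl
      · exact ⟨(abs_lt.1 ht).1, (abs_lt.1 ht).2.le⟩
  refine (key.const_mul (1 / (2 * π))).congr' ?_
  filter_upwards [eventually_gt_atTop 0] with t ht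
  exact (sqrt_mul_exp_neg_mul_besselI_zero ht).symm

lemma tendsto_mul_exp_neg_mul_besselI_zero {t : ℝ} (ht : 0 < t) :
    Tendsto (fun n : ℕ => n * (Real.exp (-(2 * (n ^ 2 * t))) * besselI 0 (2 * (n ^ 2 * t))))
      atTop (nhds ((4 * π * t) ^ (-(1 : ℝ) / 2))) := by
  have h1 : Tendsto (fun n : ℕ => 2 * ((n : ℝ) ^ 2 * t)) atTop atTop :=
    (((tendsto_pow_atTop two_ne_zero).comp tendsto_natCast_atTop_atTop).atTop_mul_const
      ht).const_mul_atTop two_pos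
  have h2 := (tendsto_sqrt_mul_exp_neg_mul_besselI_zero.comp h1).div_const √(2 * t)
  have h3 : 1 / √(2 * π) / √(2 * t) = (4 * π * t) ^ (-(1 : ℝ) / 2) := by
    rw [div_div, ← Real.sqrt_mul Real.two_pi_pos.le, neg_div, Real.rpow_neg (by positivity),
      Real.sqrt_eq_rpow, one_div]
    ring_nf
  rw [h3] at h2
  refine h2.congr fun n => ?_
  have h4 : √(2 * ((n : ℝ) ^ 2 * t)) = n * √(2 * t) := by
    rw [mul_left_comm, Real.sqrt_mul (by positivity), Real.sqrt_sq (by positivity)]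
  have h5 : 0 < √(2 * t) := Real.sqrt_pos.2 (by positivity)
  simp only [Function.comp_apply, h4]
  field_simp

lemma tendsto_circleTheta_mul {b : ℕ} (hb : 0 < b) {t : ℝ} (ht : 0 < t) :
    Tendsto (fun n : ℕ => circleTheta (b * n) (n ^ 2 * t)) atTop
      (nhds (∑' k : ℤ, Real.exp (-4 * π ^ 2 * t * ((k : ℝ) ^ 2 / (b : ℝ) ^ 2)))) := by
  have hb' : (0 : ℝ) < b := by exact_mod_cast hb
  have hx : 0 < 16 * t / (b : ℝ) ^ 2 := by positivity
  have h := tendsto_tsum_of_dominated_convergence (𝓕 := atTop)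
    (f := fun (n : ℕ) (k : ℤ) => if -((b * n : ℕ) : ℤ) < 2 * k ∧ 2 * k ≤ ((b * n : ℕ) : ℤ) then
      Real.exp (-(2 * (n ^ 2 * t) * (1 - Real.cos (2 * π * k / (b * n : ℕ))))) else 0)
    (g := fun k : ℤ => Real.exp (-4 * π ^ 2 * t * ((k : ℝ) ^ 2 / (b : ℝ) ^ 2)))
    (summable_exp_neg_mul_sq hx) ?_ ?_
  · refine h.congr' ?_
    filter_upwards [eventually_gt_atTop 0] with n hn
    exact (circleTheta_eq_tsum (Nat.mul_pos hb hn) _).symm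
  · intro k
    have hn : Tendsto (fun n : ℕ => ((b * n : ℕ) : ℝ)) atTop atTop := by
      push_cast
      exact tendsto_natCast_atTop_atTop.const_mul_atTop hb'
    have h1 : Tendsto (fun n : ℕ => 2 * ((n : ℝ) ^ 2 * t) *
        (1 - Real.cos (2 * π * k / (b * n : ℕ)))) atTop
        (nhds (8 * π ^ 2 * t * ((k : ℝ) ^ 2 / (b : ℝ) ^ 2) / 2)) := by
      refine tendsto_mul_one_sub_cos (tendsto_const_nhds.div_atTop hn) ?_
      refine tendsto_const_nhds.congr' ?_
      filter_upwards [eventually_gt_atTop 0] with n hn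
      have : (n : ℝ) ≠ 0 := by exact_mod_cast hn.ne'
      push_cast
      field_simp
      ring
    have h2 := (Real.continuous_exp.tendsto _).comp h1.neg
    rw [show -(8 * π ^ 2 * t * ((k : ℝ) ^ 2 / (b : ℝ) ^ 2) / 2) =
      -4 * π ^ 2 * t * ((k : ℝ) ^ 2 / (b : ℝ) ^ 2) by ring] at h2
    refine h2.congr' ?_
    filter_upwards [eventually_gt_atTop (2 * k.natAbs)] with n hn
    rw [if_pos]
    · rfl
    · have : n ≤ b * n := Nat.le_mul_of_pos_left n hb
      generalize b * n = m at this ⊢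
      omega
  · filter_upwards [eventually_gt_atTop 0] with n hn k
    have hn' : (0 : ℝ) < n := by exact_mod_cast hn
    rw [Real.norm_of_nonneg]
    · refine (window_exp_le (Nat.mul_pos hb hn) (by positivity) k).trans (le_of_eq ?_)
      congr 2
      push_cast
      field_simp
    · split_ifs
      exacts [(Real.exp_pos _).le, le_rfl]

lemma tendsto_circleTheta_one {N : ℕ → ℕ} (hN : ∀ n, 0 < N n)
    (hsub : Tendsto (fun n : ℕ => (N n : ℝ) / n) atTop (nhds 0)) {t : ℝ} (ht : 0 < t) :
    Tendsto (fun n : ℕ => circleTheta (N n) (n ^ 2 * t)) atTop (nhds 1) := by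
  have h1 : Tendsto (fun n : ℕ => 1 + ((N n : ℝ) / n) ^ 2 / (8 * t)) atTop (nhds 1) := by
    simpa using ((hsub.pow 2).div_const (8 * t)).const_add 1
  refine tendsto_of_tendsto_of_tendsto_of_le_of_le' tendsto_const_nhds h1
    (Eventually.of_forall fun n => one_le_circleTheta (hN n) _) ?_
  filter_upwards [eventually_gt_atTop 0] with n hn
  have hn' : (0 : ℝ) < n := by exact_mod_cast hn
  refine (circleTheta_le (hN n) (by positivity)).trans (le_of_eq ?_)
  field_simp
lemma abs_circleTheta_sub_le {N : ℕ} (hN : 0 < N) (s : ℝ) {y : ℝ} (hy : 0 < y) :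
    |circleTheta N s - N * (Real.exp (-(2 * s)) * besselI 0 (2 * s))| ≤
      N * (Real.exp (-(2 * s)) * besselI 0 (2 * s * Real.cosh y)) *
        (2 / (Real.exp (N * y) - 1)) := by
  have hN' : (0 : ℝ) < N := by exact_mod_cast hN
  have h1 := hasSum_ite_sub_hasSum (hasSum_circleTheta hN s) 0
  have h2 := (hasSum_ite_sub_hasSum (hasSum_exp_neg_abs (mul_pos hN' hy)) 0).mul_left
    (N * (Real.exp (-(2 * s)) * besselI 0 (2 * s * Real.cosh y)))
  simp only [Int.cast_zero, abs_zero, zero_mul, neg_zero, Real.exp_zero, add_sub_cancel_left,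
    mul_assoc] at h1 h2 ⊢
  have hb : ∀ k : ℤ,
      ‖if k = 0 then (0 : ℝ) else N * (Real.exp (-(2 * s)) * besselI (k * N) (2 * s))‖ ≤
        N * (Real.exp (-(2 * s)) * (besselI 0 (2 * (s * Real.cosh y)) *
          if k = 0 then 0 else Real.exp (-(|(k : ℝ)| * (N * y))))) := by
    intro k
    split_ifs
    · simp
    · have h := abs_besselI_le (k * N) (2 * s) y
      rw [Real.norm_eq_abs, abs_mul, abs_mul, abs_of_pos hN', abs_of_pos (Real.exp_pos _)]
      refine mul_le_mul_of_nonneg_left (mul_le_mul_of_nonneg_left ?_ (Real.exp_pos _).le) hN'.le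
      refine h.trans (le_of_eq ?_)
      rw [mul_comm, abs_mul, Nat.abs_cast]
      push_cast
      simp only [mul_assoc]
  have h3 := tsum_of_norm_bounded h2 hb
  rwa [h1.tsum_eq] at h3

lemma exp_neg_mul_besselI_zero_mul_cosh (s y : ℝ) :
    Real.exp (-(2 * s)) * besselI 0 (2 * s * Real.cosh y) =
      Real.exp (2 * s * (Real.cosh y - 1)) *
        (Real.exp (-(2 * s * Real.cosh y)) * besselI 0 (2 * s * Real.cosh y)) := by
  rw [← mul_assoc, ← Real.exp_add]
  ring_nf

lemma two_div_exp_sub_one_le {x : ℝ} (hx : 1 ≤ x) :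
    2 / (Real.exp x - 1) ≤ 4 / Real.exp x := by
  have h := Real.add_one_le_exp x
  rw [div_le_div_iff₀ (by linarith) (by linarith)]
  linarith

lemma inv_exp_le {x : ℝ} (hx : 0 < x) (K : ℕ) :
    1 / Real.exp x ≤ (K.factorial : ℝ) / x ^ K := by
  have h := Real.pow_div_factorial_le_exp x hx.le K
  have hK : (0 : ℝ) < K.factorial := by exact_mod_cast K.factorial_pos
  rw [div_le_iff₀ hK] at h
  rw [div_le_div_iff₀ (Real.exp_pos x) (by positivity)]
  linarith

lemma abs_circleTheta_sub_le_of_one_le {b n M : ℕ} (hb : 0 < b) (hn : 0 < n) {t : ℝ} (ht : 0 < t)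
    (ht1 : t ≤ 1) (hs : 1 ≤ (n : ℝ) ^ 2 * t) :
    |circleTheta (b * n) (n ^ 2 * t) - (b * n : ℕ) *
        (Real.exp (-(2 * (n ^ 2 * t))) * besselI 0 (2 * (n ^ 2 * t)))| ≤
      4 * Real.exp (2 * Real.exp 1) * (2 * M + 1).factorial * t ^ M := by
  have hN : 0 < b * n := Nat.mul_pos hb hn
  have hb1 : (1 : ℝ) ≤ b := by exact_mod_cast hb
  have hn0 : (0 : ℝ) < n := by exact_mod_cast hn
  set s : ℝ := (n : ℝ) ^ 2 * t with hs_def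
  have hs0 : 0 < s := by linarith
  have hrs : √s = n * √t := by rw [hs_def, Real.sqrt_mul (by positivity), Real.sqrt_sq hn0.le]
  have hrt : 0 < √t := Real.sqrt_pos.2 ht
  have hrs1 : 1 ≤ √s := Real.one_le_sqrt.2 hs
  have hrs0 : 0 < √s := by linarith
  set y : ℝ := 1 / √s with hy_def
  have hy0 : 0 < y := by positivity
  have hy2 : y ^ 2 = 1 / s := by rw [hy_def, div_pow, Real.sq_sqrt hs0.le, one_pow]
  have hys : y ^ 2 ≤ 1 := by rw [hy2, div_le_one hs0]; exact hs
  have hx : ((b * n : ℕ) : ℝ) * y = b / √t := by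
    rw [hy_def, hrs]
    push_cast
    field_simp
  set x : ℝ := b / √t with hx_def
  have hrt1 : √t ≤ 1 := Real.sqrt_le_one.2 ht1
  have hx1 : 1 ≤ x := by
    rw [hx_def, le_div_iff₀ hrt]
    linarith
  have hx0 : 0 < x := by linarith
  have hcosh : 2 * s * (Real.cosh y - 1) ≤ 2 := by
    have h1 := Real.cosh_le_exp_half_sq y
    have h2 := Real.abs_exp_sub_one_le (x := y ^ 2 / 2) (by rw [abs_of_nonneg (by positivity)]; linarith)
    rw [abs_of_nonneg (a := y ^ 2 / 2) (by positivity)] at h2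
    have h3 := (le_abs_self _).trans h2
    have h4 : Real.cosh y - 1 ≤ 1 / s := by rw [← hy2]; linarith
    calc 2 * s * (Real.cosh y - 1) ≤ 2 * s * (1 / s) := by gcongr
      _ = 2 := by field_simp
  have hexp2 : Real.exp 2 ≤ Real.exp (2 * Real.exp 1) := by
    rw [Real.exp_le_exp]
    linarith [Real.add_one_le_exp (1 : ℝ)]
  have hB : Real.exp (-(2 * s)) * besselI 0 (2 * s * Real.cosh y) ≤
      Real.exp (2 * Real.exp 1) * y := by
    rw [exp_neg_mul_besselI_zero_mul_cosh]
    have hT : s ≤ 2 * s * Real.cosh y := by nlinarith [Real.one_le_cosh y]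
    have h1 := sqrt_mul_exp_neg_mul_besselI_zero_le_one (hs0.trans_le hT)
    have h0 : 0 ≤ Real.exp (-(2 * s * Real.cosh y)) * besselI 0 (2 * s * Real.cosh y) :=
      mul_nonneg (Real.exp_pos _).le (besselI_zero_nonneg _)
    have h2 : Real.exp (-(2 * s * Real.cosh y)) * besselI 0 (2 * s * Real.cosh y) ≤ y := by
      rw [hy_def, le_div_iff₀ hrs0, mul_comm]
      exact (mul_le_mul_of_nonneg_right (Real.sqrt_le_sqrt hT) h0).trans h1
    exact mul_le_mul ((Real.exp_le_exp.2 hcosh).trans hexp2) h2 h0 (Real.exp_pos _).le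
  refine (abs_circleTheta_sub_le hN s hy0).trans ?_
  rw [hx]
  have hI := inv_exp_le hx0 (2 * M + 1)
  have hxM : 1 / x ^ (2 * M) ≤ t ^ M := by
    rw [pow_mul, hx_def, div_pow, Real.sq_sqrt ht.le, div_pow, one_div_div]
    exact div_le_self (by positivity) (one_le_pow₀ (one_le_pow₀ hb1))
  calc _ ≤ ((b * n : ℕ) : ℝ) * (Real.exp (2 * Real.exp 1) * y) * (4 / Real.exp x) := by
        have h0 : 0 ≤ 2 / (Real.exp x - 1) :=
          div_nonneg two_pos.le (by linarith [Real.add_one_le_exp x])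
        have h2 := two_div_exp_sub_one_le hx1
        gcongr
    _ = 4 * Real.exp (2 * Real.exp 1) * x * (1 / Real.exp x) := by rw [← hx]; ring
    _ ≤ 4 * Real.exp (2 * Real.exp 1) * x * ((2 * M + 1).factorial / x ^ (2 * M + 1)) := by
        gcongr
    _ = 4 * Real.exp (2 * Real.exp 1) * (2 * M + 1).factorial * (1 / x ^ (2 * M)) := by
        rw [pow_succ]; field_simp
    _ ≤ _ := by gcongr

lemma abs_circleTheta_sub_le_of_lt_one {b n M : ℕ} (hb : 0 < b) (hn : 0 < n) (hM : M ≤ n) {t : ℝ}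
    (ht : 0 < t) (hs : (n : ℝ) ^ 2 * t < 1) :
    |circleTheta (b * n) (n ^ 2 * t) - (b * n : ℕ) *
        (Real.exp (-(2 * (n ^ 2 * t))) * besselI 0 (2 * (n ^ 2 * t)))| ≤
      4 * Real.exp (2 * Real.exp 1) * (2 * M + 1).factorial * t ^ M := by
  have hN : 0 < b * n := Nat.mul_pos hb hn
  have hNn : n ≤ b * n := Nat.le_mul_of_pos_left n hb
  generalize b * n = N at hN hNn
  have hn0 : (0 : ℝ) < n := by exact_mod_cast hn
  have hN1 : (1 : ℝ) ≤ N := by exact_mod_cast hN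
  have hsN : (n : ℝ) ^ 2 * t ≤ (N : ℝ) ^ 2 * t := by gcongr
  have hs0 : 0 < (n : ℝ) ^ 2 * t := by positivity
  generalize (n : ℝ) ^ 2 * t = s at hs hsN hs0
  have hlog : Real.log s < 0 := Real.log_neg hs0 hs
  set y : ℝ := 1 - Real.log s with hy_def
  have hy1 : 1 ≤ y := by linarith
  have hey : s * Real.exp y = Real.exp 1 := by
    rw [hy_def, Real.exp_sub, Real.exp_log hs0]
    field_simp
  have hB : Real.exp (-(2 * s)) * besselI 0 (2 * s * Real.cosh y) ≤ Real.exp (2 * Real.exp 1) := by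
    have hc := Real.cosh_pos y
    rw [exp_neg_mul_besselI_zero_mul_cosh]
    refine (mul_le_of_le_one_right (Real.exp_pos _).le
      (exp_neg_mul_besselI_zero_le_one (by positivity))).trans ?_
    rw [Real.exp_le_exp]
    have h1 : Real.cosh y ≤ Real.exp y := by
      rw [Real.cosh_eq]
      have : Real.exp (-y) ≤ Real.exp y := Real.exp_le_exp.2 (by linarith)
      linarith
    calc 2 * s * (Real.cosh y - 1) ≤ 2 * s * Real.exp y := by gcongr; linarith
      _ = 2 * Real.exp 1 := by rw [mul_assoc, hey]
  refine (abs_circleTheta_sub_le hN s (zero_lt_one.trans_le hy1)).trans ?_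
  have hNy : 1 ≤ N * y := by nlinarith
  have hexp : 1 / Real.exp (N * y) = s ^ N * (1 / Real.exp N) := by
    have h1 : Real.exp N = s ^ N * Real.exp (N * y) := by
      rw [Real.exp_nat_mul, ← mul_pow, hey, ← Real.exp_nat_mul, mul_one]
    rw [h1]
    field_simp
  have hsM : s ^ N ≤ ((N : ℝ) ^ 2 * t) ^ M :=
    (pow_le_pow_of_le_one hs0.le hs.le (hM.trans hNn)).trans (pow_le_pow_left₀ hs0.le hsN M)
  have hN0 : (0 : ℝ) < N := by linarith
  calc _ ≤ (N : ℝ) * Real.exp (2 * Real.exp 1) * (4 / Real.exp (N * y)) := by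
        have h0 : 0 ≤ 2 / (Real.exp (N * y) - 1) :=
          div_nonneg two_pos.le (by linarith [Real.add_one_le_exp (N * y)])
        have h2 := two_div_exp_sub_one_le hNy
        gcongr
    _ = 4 * Real.exp (2 * Real.exp 1) * N * (1 / Real.exp (N * y)) := by ring
    _ ≤ 4 * Real.exp (2 * Real.exp 1) * N * (((N : ℝ) ^ 2 * t) ^ M *
          ((2 * M + 1).factorial / (N : ℝ) ^ (2 * M + 1))) := by
        rw [hexp]
        have hI := inv_exp_le hN0 (2 * M + 1)
        gcongr
    _ = _ := by
        rw [mul_pow, ← pow_mul, pow_succ]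
        field_simp

lemma abs_circleTheta_sub_le_mul_pow {b n M : ℕ} (hb : 0 < b) (hn : 0 < n) (hM : M ≤ n) {t : ℝ}
    (ht : 0 < t) (ht1 : t ≤ 1) :
    |circleTheta (b * n) (n ^ 2 * t) - (b * n : ℕ) *
        (Real.exp (-(2 * (n ^ 2 * t))) * besselI 0 (2 * (n ^ 2 * t)))| ≤
      4 * Real.exp (2 * Real.exp 1) * (2 * M + 1).factorial * t ^ M := by
  rcases le_or_gt 1 ((n : ℝ) ^ 2 * t) with h | h
  · exact abs_circleTheta_sub_le_of_one_le hb hn ht ht1 h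
  · exact abs_circleTheta_sub_le_of_lt_one hb hn hM ht h

lemma abs_prod_sub_prod_le {ι : Type*} (s : Finset ι) {x y : ι → ℝ} {R ε : ℝ} (hR : 1 ≤ R)
    (hε : 0 ≤ ε) (hx : ∀ i, |x i| ≤ R) (hy : ∀ i, |y i| ≤ R) (hxy : ∀ i, |x i - y i| ≤ ε) :
    |∏ i ∈ s, x i - ∏ i ∈ s, y i| ≤ s.card * R ^ s.card * ε := by
  classical
  induction s using Finset.induction_on with
  | empty => simp
  | insert i s hi ih =>
    rw [Finset.prod_insert hi, Finset.prod_insert hi, Finset.card_insert_of_notMem hi]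
    have h1 : |∏ j ∈ s, x j| ≤ R ^ s.card := by
      rw [abs_prod]
      exact (Finset.prod_le_prod (fun _ _ => abs_nonneg _) fun j _ => hx j).trans (by simp)
    have h2 : x i * ∏ j ∈ s, x j - y i * ∏ j ∈ s, y j =
        (x i - y i) * ∏ j ∈ s, x j + y i * (∏ j ∈ s, x j - ∏ j ∈ s, y j) := by ring
    have hR0 : 0 ≤ R := by linarith
    rw [h2]
    calc _ ≤ |x i - y i| * |∏ j ∈ s, x j| + |y i| * |∏ j ∈ s, x j - ∏ j ∈ s, y j| := by
          rw [← abs_mul, ← abs_mul]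
          exact abs_add_le _ _
      _ ≤ ε * R ^ s.card + R * (s.card * R ^ s.card * ε) :=
          add_le_add (mul_le_mul (hxy i) h1 (abs_nonneg _) hε)
            (mul_le_mul (hy i) ih (abs_nonneg _) hR0)
      _ ≤ R * (ε * R ^ s.card) + R * (s.card * R ^ s.card * ε) :=
          add_le_add (le_mul_of_one_le_left (by positivity) hR) le_rfl
      _ = _ := by push_cast; ring

lemma summable_and_tsum_pi_prod {p : ℕ} (f : Fin p → ℤ → ℝ)
    (hf : ∀ i, Summable fun k => ‖f i k‖) :
    (Summable fun k : Fin p → ℤ => ‖∏ i, f i (k i)‖) ∧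
      ∑' k : Fin p → ℤ, ∏ i, f i (k i) = ∏ i, ∑' k, f i k := by
  induction p with
  | zero => exact ⟨Summable.of_finite, by simp [tsum_fintype]⟩
  | succ p ih =>
    obtain ⟨h1, h2⟩ := ih (fun i => f i.succ) fun i => hf i.succ
    obtain ⟨e, he⟩ : ∃ e : ℤ × (Fin p → ℤ) ≃ (Fin (p + 1) → ℤ),
        ∀ x, ∏ i, f i (e x i) = f 0 x.1 * ∏ i : Fin p, f i.succ (x.2 i) := by
      refine ⟨Fin.consEquiv (fun _ => ℤ), fun x => ?_⟩
      rw [Fin.prod_univ_succ]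
      simp [Fin.consEquiv]
    let g : (Fin p → ℤ) → ℝ := fun k => ∏ i : Fin p, f i.succ (k i)
    constructor
    · have h4 : Summable fun x : ℤ × (Fin p → ℤ) => ‖f 0 x.1 * g x.2‖ :=
        Summable.mul_norm (f := f 0) (g := g) (hf 0) h1
      exact e.summable_iff.1 (h4.congr fun x => congrArg norm (he x).symm)
    · have h3 : (∑' k, f 0 k) * ∑' k, g k = ∑' x : ℤ × (Fin p → ℤ), f 0 x.1 * g x.2 :=
        tsum_mul_tsum_of_summable_norm (f := f 0) (g := g) (hf 0) h1
      calc ∑' k : Fin (p + 1) → ℤ, ∏ i, f i (k i) = ∑' x, ∏ i, f i (e x i) :=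
            (e.tsum_eq fun k : Fin (p + 1) → ℤ => ∏ i, f i (k i)).symm
        _ = ∑' x : ℤ × (Fin p → ℤ), f 0 x.1 * ∏ i : Fin p, f i.succ (x.2 i) := tsum_congr he
        _ = _ := by rw [← h3, h2, Fin.prod_univ_succ]
lemma torusTheta_eq_prod {d p : ℕ} (hpd : p < d) (α : Fin p → ℕ) (β : Fin (d - p) → ℕ)
    (a n : ℕ) (s : ℝ) :
    torusTheta d p α β a n s =
      (∏ i, circleTheta (α i * a) s) * ∏ i, circleTheta (β i * n) s := by
  have hfac : ∀ {q : ℕ} (N : Fin q → ℕ), ∏ i, circleTheta (N i) s =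
      ∑ x : (i : Fin q) → Fin (N i),
        ∏ i, Real.exp (-(2 * s * (1 - Real.cos (2 * π * (x i : ℕ) / N i)))) := by
    intro q N
    simp only [circleTheta, Finset.sum_range]
    rw [Finset.prod_univ_sum, Fintype.piFinset_univ]
  rw [hfac, hfac, Finset.sum_mul_sum, ← Finset.sum_product', Finset.univ_product_univ, torusTheta]
  refine Finset.sum_congr rfl fun x _ => ?_
  rw [← Real.exp_sum, ← Real.exp_sum, ← Real.exp_add]
  congr 1
  have hd : (d : ℝ) = p + (d - p : ℕ) := by
    rw [Nat.cast_sub hpd.le]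
    ring
  simp only [Finset.sum_neg_distrib, ← Finset.mul_sum, Finset.sum_sub_distrib, torusLam,
    Finset.sum_const, Finset.card_univ, Fintype.card_fin, nsmul_eq_mul, mul_one, Nat.cast_mul, hd]
  ring

lemma ThetaB_eq_prod (d p : ℕ) (β : Fin (d - p) → ℕ) (hβ : ∀ i, 0 < β i) {t : ℝ} (ht : 0 < t) :
    ThetaB d p β t =
      ∏ i, ∑' k : ℤ, Real.exp (-4 * π ^ 2 * t * ((k : ℝ) ^ 2 / (β i : ℝ) ^ 2)) := by
  rw [← (summable_and_tsum_pi_prod _ fun i => ?_).2, ThetaB]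
  · refine tsum_congr fun k => ?_
    rw [Finset.mul_sum, Real.exp_sum]
  · have hb : (0 : ℝ) < β i := by exact_mod_cast hβ i
    have hx : 0 < 4 * π ^ 2 * t / (β i : ℝ) ^ 2 := by positivity
    refine (summable_exp_neg_mul_sq hx).congr fun k => ?_
    rw [Real.norm_of_nonneg (Real.exp_pos _).le]
    congr 1
    ring

lemma mul_tsum_prod_besselI {p : ℕ} (N : Fin p → ℕ) (hN : ∀ i, 0 < N i) (s : ℝ) :
    (∏ i, (N i : ℝ)) * Real.exp (-(2 * s)) ^ p *
      ∑' k : Fin p → ℤ, ∏ i, besselI (k i * N i) (2 * s) = ∏ i, circleTheta (N i) s := by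
  rw [(summable_and_tsum_pi_prod (fun i k => besselI (k * N i) (2 * s)) fun i => ?_).2,
    ← Fin.prod_const, ← Finset.prod_mul_distrib, ← Finset.prod_mul_distrib]
  · refine Finset.prod_congr rfl fun i _ => ?_
    rw [← (hasSum_circleTheta (hN i) s).tsum_eq, tsum_mul_left]
  · have hx : 0 < ((N i : ℕ) : ℝ) := by exact_mod_cast hN i
    refine Summable.norm ?_
    have h := (hasSum_circleTheta (hN i) s).summable
    rwa [summable_mul_left_iff (by positivity)] at h

/-- The contribution of the zero mode to the theta function of `ℤ/Nℤ`, after Poisson summation. -/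
noncomputable def circleZeroMode (N : ℕ) (s : ℝ) : ℝ :=
  N * (Real.exp (-(2 * s)) * besselI 0 (2 * s))

lemma continuous_circleZeroMode (N : ℕ) : Continuous (circleZeroMode N) := by
  have := continuous_besselI 0
  unfold circleZeroMode
  fun_prop

lemma circleZeroMode_nonneg (N : ℕ) (s : ℝ) : 0 ≤ circleZeroMode N s :=
  mul_nonneg N.cast_nonneg (mul_nonneg (Real.exp_pos _).le (besselI_zero_nonneg _))

lemma circleZeroMode_mul_le {b n : ℕ} (hn : 0 < n) {t : ℝ} (ht : 0 < t) (ht1 : t ≤ 1) :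
    circleZeroMode (b * n) (n ^ 2 * t) ≤ b / t := by
  have hn0 : (0 : ℝ) < n := by exact_mod_cast hn
  have hs : 0 < 2 * ((n : ℝ) ^ 2 * t) := by positivity
  have h := sqrt_mul_exp_neg_mul_besselI_zero_le_one hs
  have h1 : n * t ≤ √(2 * ((n : ℝ) ^ 2 * t)) := by
    refine Real.le_sqrt_of_sq_le ?_
    have : t ^ 2 ≤ 2 * t := by nlinarith
    nlinarith [sq_nonneg (n : ℝ)]
  have h0 : 0 ≤ Real.exp (-(2 * ((n : ℝ) ^ 2 * t))) * besselI 0 (2 * (n ^ 2 * t)) :=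
    mul_nonneg (Real.exp_pos _).le (besselI_zero_nonneg _)
  have h2 := (mul_le_mul_of_nonneg_right h1 h0).trans h
  rw [circleZeroMode, le_div_iff₀ ht]
  push_cast
  calc _ = (b : ℝ) * (n * t * (Real.exp (-(2 * ((n : ℝ) ^ 2 * t))) *
        besselI 0 (2 * (n ^ 2 * t)))) := by ring
    _ ≤ b * 1 := by gcongr
    _ = b := mul_one _

lemma circleTheta_mul_le {b n : ℕ} (hb : 0 < b) (hn : 0 < n) {t : ℝ} (ht : 0 < t) (ht1 : t ≤ 1) :
    circleTheta (b * n) (n ^ 2 * t) ≤ (1 + (b : ℝ) ^ 2) / t := by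
  have hn0 : (0 : ℝ) < n := by exact_mod_cast hn
  refine (circleTheta_le (Nat.mul_pos hb hn) (by positivity)).trans ?_
  push_cast
  rw [le_div_iff₀ ht]
  have : (1 + ((b : ℝ) * n) ^ 2 / (8 * (n ^ 2 * t))) * t = t + b ^ 2 / 8 := by
    field_simp
  rw [this]
  nlinarith [sq_nonneg (b : ℝ)]

lemma circleTheta_le_two_div {N n : ℕ} (hN : 0 < N) (hn : 0 < n) (hNn : (N : ℝ) / n ≤ 1) {t : ℝ}
    (ht : 0 < t) (ht1 : t ≤ 1) : circleTheta N (n ^ 2 * t) ≤ 2 / t := by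
  have hn0 : (0 : ℝ) < n := by exact_mod_cast hn
  refine (circleTheta_le hN (by positivity)).trans ?_
  rw [le_div_iff₀ ht]
  have h1 : (1 + (N : ℝ) ^ 2 / (8 * (n ^ 2 * t))) * t = t + ((N : ℝ) / n) ^ 2 / 8 := by
    field_simp
  rw [h1]
  have h2 : ((N : ℝ) / n) ^ 2 ≤ 1 := pow_le_one₀ (by positivity) hNn
  linarith

lemma torusTheta_sub_eq {d p : ℕ} (hpd : p < d) (α : Fin p → ℕ) (hα : ∀ i, 0 < α i)
    (β : Fin (d - p) → ℕ) {a : ℕ} (ha : 0 < a) (n : ℕ) (t : ℝ) :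
    torusTheta d p α β a n (n ^ 2 * t)
        - ((a : ℝ) ^ p * (n : ℝ) ^ (d - p) * (∏ i, (α i : ℝ)) * ∏ i, (β i : ℝ)) *
            Real.exp (-(2 * d) * n ^ 2 * t) * (besselI 0 (2 * n ^ 2 * t)) ^ (d - p) *
            ∑' k : Fin p → ℤ, ∏ i, besselI (k i * α i * a) (2 * n ^ 2 * t) =
      (∏ i, circleTheta (α i * a) (n ^ 2 * t)) *
        (∏ i, circleTheta (β i * n) (n ^ 2 * t) - ∏ i, circleZeroMode (β i * n) (n ^ 2 * t)) := by
  rw [torusTheta_eq_prod hpd, mul_sub]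
  congr 1
  rw [← mul_tsum_prod_besselI (fun i => α i * a) (fun i => Nat.mul_pos (hα i) ha)]
  have h2 : 2 * (n : ℝ) ^ 2 * t = 2 * (n ^ 2 * t) := by ring
  have hexp : Real.exp (-(2 * d) * n ^ 2 * t) =
      Real.exp (-(2 * ((n : ℝ) ^ 2 * t))) ^ p * Real.exp (-(2 * ((n : ℝ) ^ 2 * t))) ^ (d - p) := by
    rw [← pow_add, Nat.add_sub_cancel' hpd.le, ← Real.exp_nat_mul]
    ring_nf
  have hk : ∀ k : Fin p → ℤ, ∏ i, besselI (k i * α i * a) (2 * (n ^ 2 * t)) =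
      ∏ i, besselI (k i * (α i * a : ℕ)) (2 * (n ^ 2 * t)) := by
    intro k
    refine Finset.prod_congr rfl fun i _ => ?_
    push_cast
    rw [mul_assoc]
  simp only [h2, hexp, hk, circleZeroMode, Finset.prod_mul_distrib, Fin.prod_const, Nat.cast_mul]
  ring

lemma tendsto_torusTheta_sub_div {d p : ℕ} (α : Fin p → ℕ) (hα : ∀ i, 0 < α i)
    (β : Fin (d - p) → ℕ) (hβ : ∀ i, 0 < β i) (a : ℕ → ℕ) (ha : ∀ n, 0 < a n)
    (hsub : Tendsto (fun n : ℕ => (a n : ℝ) / n) atTop (nhds 0)) {t : ℝ} (ht : 0 < t) :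
    Tendsto (fun n : ℕ => (∏ i, circleTheta (α i * a n) (n ^ 2 * t)) *
        (∏ i, circleTheta (β i * n) (n ^ 2 * t) - ∏ i, circleZeroMode (β i * n) (n ^ 2 * t)) / t)
      atTop (nhds ((ThetaB d p β t
          - (∏ i, (β i : ℝ)) * (4 * π * t) ^ (-(((d - p : ℕ) : ℝ)) / 2)) / t)) := by
  have hA : Tendsto (fun n : ℕ => ∏ i, circleTheta (α i * a n) (n ^ 2 * t)) atTop (nhds 1) := by
    have h := tendsto_finsetProd (Finset.univ : Finset (Fin p)) fun i _ =>
      tendsto_circleTheta_one (N := fun n => α i * a n) (fun n => Nat.mul_pos (hα i) (ha n))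
        (by simpa [mul_div_assoc] using hsub.const_mul (α i : ℝ)) ht
    simpa using h
  have hB := tendsto_finsetProd (Finset.univ : Finset (Fin (d - p))) fun i _ =>
    tendsto_circleTheta_mul (hβ i) ht
  have hZ : Tendsto (fun n : ℕ => ∏ i, circleZeroMode (β i * n) (n ^ 2 * t)) atTop
      (nhds ((∏ i, (β i : ℝ)) * (4 * π * t) ^ (-(((d - p : ℕ) : ℝ)) / 2))) := by
    have h := tendsto_finsetProd (Finset.univ : Finset (Fin (d - p))) fun i _ =>
      (tendsto_mul_exp_neg_mul_besselI_zero ht).const_mul (β i : ℝ)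
    rw [Finset.prod_mul_distrib, Fin.prod_const, ← Real.rpow_mul_natCast (by positivity)] at h
    rw [show (-(((d - p : ℕ) : ℝ)) / 2) = -(1 : ℝ) / 2 * (d - p : ℕ) by ring]
    simpa only [circleZeroMode, Nat.cast_mul, mul_assoc] using h
  rw [ThetaB_eq_prod d p β hβ ht]
  simpa only [one_mul] using (hA.mul (hB.sub hZ)).div_const t

lemma exists_abs_torusTheta_sub_div_le {d p : ℕ} (hpd : p < d) (α : Fin p → ℕ)
    (hα : ∀ i, 0 < α i) (β : Fin (d - p) → ℕ) (hβ : ∀ i, 0 < β i) (a : ℕ → ℕ)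
    (ha : ∀ n, 0 < a n) (hsub : Tendsto (fun n : ℕ => (a n : ℝ) / n) atTop (nhds 0)) :
    ∃ K : ℝ, ∀ᶠ n : ℕ in atTop, ∀ t ∈ Set.Ioc (0 : ℝ) 1,
      |(∏ i, circleTheta (α i * a n) (n ^ 2 * t)) *
        (∏ i, circleTheta (β i * n) (n ^ 2 * t) -
          ∏ i, circleZeroMode (β i * n) (n ^ 2 * t)) / t| ≤ K := by
  set D : ℝ := 1 + ∑ i, (β i : ℝ) ^ 2 with hD
  have hD1 : 1 ≤ D := by
    have : 0 ≤ ∑ i, (β i : ℝ) ^ 2 := by positivity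
    linarith
  have hβD : ∀ i, 1 + (β i : ℝ) ^ 2 ≤ D := fun i => by
    have := Finset.single_le_sum (f := fun i => (β i : ℝ) ^ 2) (fun _ _ => sq_nonneg _)
      (Finset.mem_univ i)
    linarith
  set C : ℝ := 4 * Real.exp (2 * Real.exp 1) * (2 * (d + 1) + 1).factorial with hC
  have hC0 : 0 ≤ C := by positivity
  refine ⟨2 ^ p * ((d - p : ℕ) * D ^ (d - p) * C), ?_⟩
  have hαn : ∀ᶠ n : ℕ in atTop, ∀ i, ((α i * a n : ℕ) : ℝ) / n ≤ 1 := by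
    rw [eventually_all]
    intro i
    have h : Tendsto (fun n : ℕ => ((α i * a n : ℕ) : ℝ) / n) atTop (nhds 0) := by
      simpa [mul_div_assoc] using hsub.const_mul (α i : ℝ)
    exact h.eventually_le_const one_pos
  filter_upwards [hαn, eventually_ge_atTop (d + 1)] with n hαn hn t ht
  obtain ⟨ht0, ht1⟩ := ht
  have hn0 : 0 < n := by omega
  have hA : |∏ i, circleTheta (α i * a n) (n ^ 2 * t)| ≤ (2 / t) ^ p := by
    rw [abs_prod]
    refine (Finset.prod_le_prod (g := fun _ => 2 / t) (fun _ _ => abs_nonneg _)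
      fun i _ => ?_).trans (by simp [div_pow])
    rw [abs_of_nonneg (circleTheta_nonneg _ _)]
    exact circleTheta_le_two_div (Nat.mul_pos (hα i) (ha n)) hn0 (hαn i) ht0 ht1
  have hBZ := abs_prod_sub_prod_le (Finset.univ : Finset (Fin (d - p)))
    (x := fun i => circleTheta (β i * n) (n ^ 2 * t))
    (y := fun i => circleZeroMode (β i * n) (n ^ 2 * t)) (R := D / t) (ε := C * t ^ (d + 1))
    ((one_le_div ht0).2 (ht1.trans hD1)) (by positivity)
    (fun i => by
      rw [abs_of_nonneg (circleTheta_nonneg _ _)]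
      refine (circleTheta_mul_le (hβ i) hn0 ht0 ht1).trans ?_
      gcongr
      exact hβD i)
    (fun i => by
      rw [abs_of_nonneg (circleZeroMode_nonneg _ _)]
      refine (circleZeroMode_mul_le hn0 ht0 ht1).trans ?_
      gcongr
      nlinarith [hβD i, sq_nonneg ((β i : ℝ) - 1)])
    (fun i => abs_circleTheta_sub_le_mul_pow (hβ i) hn0 hn ht0 ht1)
  rw [Finset.card_univ, Fintype.card_fin] at hBZ
  rw [abs_div, abs_mul, abs_of_pos ht0, div_le_iff₀ ht0]
  refine (mul_le_mul hA hBZ (abs_nonneg _) (by positivity)).trans (le_of_eq ?_)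
  have hpow : t ^ (d + 1) = t ^ p * t ^ (d - p) * t := by
    rw [← pow_add, Nat.add_sub_cancel' hpd.le, pow_succ]
  rw [hpow, div_pow, div_pow]
  field_simp

theorem torus_theta_integral_limit_small (d p : ℕ) (hp : 1 ≤ p) (hpd : p < d)
    (α : Fin p → ℕ) (hα : ∀ i, 0 < α i) (β : Fin (d - p) → ℕ) (hβ : ∀ i, 0 < β i)
    (a : ℕ → ℕ) (ha : ∀ n, 0 < a n)
    (hsub : Tendsto (fun n : ℕ => (a n : ℝ) / n) atTop (nhds 0)) :
    Tendsto (fun n : ℕ =>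
        ∫ t in Set.Ioc (0 : ℝ) 1,
          (torusTheta d p α β (a n) n (n ^ 2 * t)
            - ((a n : ℝ) ^ p * (n : ℝ) ^ (d - p) * (∏ i, (α i : ℝ)) * ∏ i, (β i : ℝ)) *
                Real.exp (-(2 * d) * n ^ 2 * t) * (besselI 0 (2 * n ^ 2 * t)) ^ (d - p) *
                ∑' k : Fin p → ℤ, ∏ i, besselI (k i * α i * a n) (2 * n ^ 2 * t)) / t)
      atTop
      (nhds (∫ t in Set.Ioc (0 : ℝ) 1,
        (ThetaB d p β t
          - (∏ i, (β i : ℝ)) * (4 * π * t) ^ (-(((d - p : ℕ) : ℝ)) / 2)) / t)) := by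
  have hmain : ∀ n : ℕ, (∫ t in Set.Ioc (0 : ℝ) 1,
          (torusTheta d p α β (a n) n (n ^ 2 * t)
            - ((a n : ℝ) ^ p * (n : ℝ) ^ (d - p) * (∏ i, (α i : ℝ)) * ∏ i, (β i : ℝ)) *
                Real.exp (-(2 * d) * n ^ 2 * t) * (besselI 0 (2 * n ^ 2 * t)) ^ (d - p) *
                ∑' k : Fin p → ℤ, ∏ i, besselI (k i * α i * a n) (2 * n ^ 2 * t)) / t) =
      ∫ t in Set.Ioc (0 : ℝ) 1, (∏ i, circleTheta (α i * a n) (n ^ 2 * t)) *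
        (∏ i, circleTheta (β i * n) (n ^ 2 * t) -
          ∏ i, circleZeroMode (β i * n) (n ^ 2 * t)) / t := by
    intro n
    simp only [torusTheta_sub_eq hpd α hα β (ha n) n]
  simp only [hmain]
  obtain ⟨K, hK⟩ := exists_abs_torusTheta_sub_div_le hpd α hα β hβ a ha hsub
  refine tendsto_integral_filter_of_dominated_convergence (fun _ => K) ?_ ?_
    (integrable_const K) ?_
  · refine Eventually.of_forall fun n => Measurable.aestronglyMeasurable ?_
    have h1 := continuous_circleTheta
    have h2 := continuous_circleZeroMode
    refine Measurable.div (Continuous.measurable ?_) measurable_id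
    fun_prop
  · filter_upwards [hK] with n hn
    exact ae_restrict_of_forall_mem measurableSet_Ioc hn
  · exact ae_restrict_of_forall_mem measurableSet_Ioc fun t ht =>
      tendsto_torusTheta_sub_div α hα β hβ a ha hsub ht.1
end

section
/- As the real number x tends to infinity, ∫_0^1 (e^{−x²t} − 1) dt/t = −γ_E − 2·log x + o(1), where γ_E is the Euler–Mascheroni constant; that is, ∫_0^1 (e^{−x²t} − 1) dt/t + γ_E + 2·log x → 0 as x → ∞. -/
open Real MeasureTheory Filter

/-- The integral of `log` against the exponential density is minus the Euler–Mascheroni constant. -/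
lemma integral_exp_neg_mul_log :
    ∫ t in Set.Ioi (0 : ℝ), Real.exp (-t) * Real.log t = -Real.eulerMascheroniConstant := by
  have h1 := Complex.hasDerivAt_GammaIntegral (s := 1) (by simp)
  have h2 : Complex.GammaIntegral =ᶠ[nhds 1] Complex.Gamma := by
    have : {s : ℂ | 0 < s.re} ∈ nhds (1 : ℂ) :=
      (isOpen_lt continuous_const Complex.continuous_re).mem_nhds (by simp)
    filter_upwards [this] with s hs using (Complex.Gamma_eq_integral hs).symm
  have h3 := (h1.congr_of_eventuallyEq h2.symm).unique Complex.hasDerivAt_Gamma_one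
  have h4 : ((∫ t in Set.Ioi (0 : ℝ), Real.exp (-t) * Real.log t : ℝ) : ℂ)
      = ((-Real.eulerMascheroniConstant : ℝ) : ℂ) := by
    rw [← integral_complex_ofReal]
    push_cast
    rw [← h3]
    refine setIntegral_congr_fun measurableSet_Ioi fun t ht => ?_
    simp [mul_comm]
  exact_mod_cast h4

lemma integrableOn_exp_neg_mul_log :
    IntegrableOn (fun t : ℝ => Real.exp (-t) * Real.log t) (Set.Ioi 0) := by
  by_contra h
  have h1 := integral_exp_neg_mul_log
  rw [integral_undef h] at h1
  linarith [Real.one_half_lt_eulerMascheroniConstant]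

lemma integral_exp_neg_sub_one_div {A : ℝ} (hA : 0 < A) :
    ∫ s in (0 : ℝ)..A, (Real.exp (-s) - 1) / s
      = (Real.exp (-A) - 1) * Real.log A + ∫ s in (0 : ℝ)..A, Real.exp (-s) * Real.log s := by
  set D : ℝ → ℝ := dslope (fun s : ℝ => Real.exp (-s) - 1) 0 with hD
  have hDs : ∀ s, s ≠ 0 → D s = (Real.exp (-s) - 1) / s := fun s hs => by
    rw [hD, dslope_of_ne _ hs, slope_def_field]
    simp
  have hDc : Continuous D := by
    rw [continuous_iff_continuousAt]
    intro s
    rcases eq_or_ne s 0 with rfl | hs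
    · exact continuousAt_dslope_same.2 (by fun_prop)
    · exact (continuousAt_dslope_of_ne hs).2 (by fun_prop)
  have hI : IntervalIntegrable (fun s : ℝ => Real.exp (-s) * Real.log s) volume 0 A := by
    rw [intervalIntegrable_iff_integrableOn_Ioc_of_le hA.le]
    exact integrableOn_exp_neg_mul_log.mono_set Set.Ioc_subset_Ioi_self
  have hDI : ∫ s in (0 : ℝ)..A, (Real.exp (-s) - 1) / s = ∫ s in (0 : ℝ)..A, D s := by
    rw [intervalIntegral.integral_of_le hA.le, intervalIntegral.integral_of_le hA.le]
    exact setIntegral_congr_fun measurableSet_Ioc fun s hs => (hDs s hs.1.ne').symm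
  have key := intervalIntegral.integral_eq_sub_of_hasDerivAt_of_le hA.le
    (f := fun s => D s * (s * Real.log s)) (f' := fun s => D s - Real.exp (-s) * Real.log s)
    (hDc.mul Real.continuous_mul_log).continuousOn
    (fun s hs => by
      have hs0 := hs.1.ne'
      have hd : HasDerivAt (fun s : ℝ => (Real.exp (-s) - 1) * Real.log s)
          (D s - Real.exp (-s) * Real.log s) s := by
        refine (((hasDerivAt_neg s).exp.sub_const 1).mul (Real.hasDerivAt_log hs0)).congr_deriv ?_
        rw [hDs s hs0]
        ring
      refine hd.congr_of_eventuallyEq ?_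
      filter_upwards [isOpen_ne.mem_nhds hs0] with r hr
      have hr : r ≠ 0 := hr
      rw [hDs r hr]
      field_simp)
    ((hDc.intervalIntegrable 0 A).sub hI)
  rw [intervalIntegral.integral_sub (hDc.intervalIntegrable 0 A) hI, hDs A hA.ne'] at key
  rw [hDI]
  have : (Real.exp (-A) - 1) / A * (A * Real.log A) = (Real.exp (-A) - 1) * Real.log A := by
    field_simp
  simp only [this, zero_mul, mul_zero, sub_zero] at key
  linarith

lemma tendsto_exp_neg_mul_log_atTop :
    Tendsto (fun A : ℝ => Real.exp (-A) * Real.log A) atTop (nhds 0) := by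
  have h := Real.tendsto_pow_mul_exp_neg_atTop_nhds_zero 1
  refine squeeze_zero' ?_ ?_ h
  · filter_upwards [eventually_ge_atTop 1] with A hA
    exact mul_nonneg (Real.exp_pos _).le (Real.log_nonneg hA)
  · filter_upwards [eventually_ge_atTop 0] with A hA
    rw [pow_one, mul_comm]
    exact mul_le_mul_of_nonneg_right (Real.log_le_self hA) (Real.exp_pos _).le

lemma tendsto_integral_exp_neg_sub_one_div_add_log :
    Tendsto (fun A : ℝ => (∫ s in (0 : ℝ)..A, (Real.exp (-s) - 1) / s) + Real.log A)
      atTop (nhds (-Real.eulerMascheroniConstant)) := by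
  have h := intervalIntegral_tendsto_integral_Ioi 0 integrableOn_exp_neg_mul_log tendsto_id
  rw [integral_exp_neg_mul_log] at h
  have h' := tendsto_exp_neg_mul_log_atTop.add h
  rw [zero_add] at h'
  refine h'.congr' ?_
  filter_upwards [eventually_gt_atTop 0] with A hA
  rw [integral_exp_neg_sub_one_div hA, id]
  ring

theorem exp_integral_asymptotics :
    Tendsto (fun x : ℝ =>
        (∫ t in Set.Ioc (0 : ℝ) 1, (Real.exp (-x ^ 2 * t) - 1) / t)
          + Real.eulerMascheroniConstant + 2 * Real.log x)
      atTop (nhds 0) := by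
  have h := (tendsto_integral_exp_neg_sub_one_div_add_log.comp
    (tendsto_pow_atTop (α := ℝ) two_ne_zero)).add_const Real.eulerMascheroniConstant
  rw [neg_add_cancel] at h
  refine h.congr' ?_
  filter_upwards [eventually_gt_atTop 0] with x hx
  have hx2 : x ^ 2 ≠ 0 := by positivity
  have hsub : ∫ s in (0 : ℝ)..x ^ 2, (Real.exp (-s) - 1) / s
      = ∫ t in (0 : ℝ)..1, (Real.exp (-x ^ 2 * t) - 1) / t := by
    have := intervalIntegral.mul_integral_comp_mul_left (a := 0) (b := 1)
      (f := fun s : ℝ => (Real.exp (-s) - 1) / s) (x ^ 2)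
    rw [mul_zero, mul_one] at this
    rw [← this, ← intervalIntegral.integral_const_mul]
    refine intervalIntegral.integral_congr fun t _ => ?_
    rw [neg_mul, ← mul_div_assoc, mul_div_mul_left _ _ hx2]
  rw [← intervalIntegral.integral_of_le zero_le_one, ← hsub]
  simp only [Function.comp_apply, Real.log_pow]
  push_cast
  ring
end
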